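/- arXiv:1008.0204 — 12 statements merged into one kernel-verified Lean document; each statement's English description precedes it below -/
import Mathlib

section
/- Let q ≥ 2 and N ≥ 1, and let X = {0,…,q−1}^N. If m ≥ q^{N−1}, then every strictly positive probability distribution p on X can be written as p = ∑_{i=1}^m α_i f_i where each f_i is a strictly positive product distribution on X, each α_i ≥ 0, and ∑_{i=1}^m α_i = 1. -/
/-- A probability distribution on a finite set `X`. -/
def IsDist {X : Type*} [Fintype X] (p : X → ℝ) : Prop :=
  (∀ x, 0 ≤ p x) ∧ ∑ x, p x = 1

/-- A product distribution on `X = X_1 × ⋯ × X_N`. -/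
def IsProductDist {N : ℕ} {X : Fin N → Type*} [∀ i, Fintype (X i)]
    (p : ((i : Fin N) → X i) → ℝ) : Prop :=
  ∃ f : (i : Fin N) → X i → ℝ, (∀ i, IsDist (f i)) ∧ ∀ x, p x = ∏ i, f i (x i)

open Filter Topology Matrix in
/-- Near a parameter at which a continuous family of square matrices is the identity, a positive
vector has positive preimages. -/
theorem Matrix.eventually_exists_pos_mulVec_eq {Y : Type*} [Fintype Y] [DecidableEq Y]
    {M : ℝ → Matrix Y Y ℝ} (hM : Continuous M) (hM0 : M 0 = 1) {v : Y → ℝ} (hv : ∀ y, 0 < v y) :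
    ∀ᶠ ε in 𝓝 (0 : ℝ), ∃ g : Y → ℝ, (∀ y, 0 < g y) ∧ M ε *ᵥ g = v := by
  have hdet : ∀ᶠ ε in 𝓝 (0 : ℝ), 0 < (M ε).det :=
    hM.matrix_det.continuousAt.eventually (lt_mem_nhds (by simp [hM0]))
  have hadj : ∀ᶠ ε in 𝓝 (0 : ℝ), ∀ y, 0 < ((M ε).adjugate *ᵥ v) y := by
    rw [eventually_all]
    intro y
    have hc : Continuous fun ε => ((M ε).adjugate *ᵥ v) y :=
      (continuous_apply y).comp (hM.matrix_adjugate.matrix_mulVec continuous_const)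
    exact hc.continuousAt.eventually (lt_mem_nhds (by simpa [hM0] using hv y))
  filter_upwards [hdet, hadj] with ε h₁ h₂
  refine ⟨(M ε).det⁻¹ • ((M ε).adjugate *ᵥ v), fun y => ?_, ?_⟩
  · exact mul_pos (inv_pos.2 h₁) (h₂ y)
  · rw [Matrix.mulVec_smul, Matrix.mulVec_mulVec, Matrix.mul_adjugate, Matrix.smul_mulVec,
      Matrix.one_mulVec, smul_smul, inv_mul_cancel₀ h₁.ne', one_smul]

/-- The mixture of the point mass at `a` and the uniform distribution, with weights `1 - ε`
and `ε`. -/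
noncomputable def smoothedPointMass {q : ℕ} (ε : ℝ) (a b : Fin q) : ℝ :=
  (1 - ε) * (if a = b then 1 else 0) + ε / q

theorem smoothedPointMass_pos {q : ℕ} {ε : ℝ} (h₀ : 0 < ε) (h₁ : ε < 1) (a b : Fin q) :
    0 < smoothedPointMass ε a b := by
  have hq : (0 : ℝ) < q := by exact_mod_cast a.pos
  have : 0 ≤ (1 - ε) * (if a = b then 1 else 0) :=
    mul_nonneg (by linarith) (by split_ifs <;> simp)
  have := div_pos h₀ hq
  unfold smoothedPointMass
  linarith

theorem sum_smoothedPointMass {q : ℕ} (ε : ℝ) (a : Fin q) :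
    ∑ b, smoothedPointMass ε a b = 1 := by
  have hq : (q : ℝ) ≠ 0 := by exact_mod_cast a.pos.ne'
  simp only [smoothedPointMass, Finset.sum_add_distrib, ← Finset.mul_sum, Finset.sum_ite_eq,
    Finset.mem_univ, if_true, Finset.sum_const, Finset.card_univ, Fintype.card_fin, nsmul_eq_mul]
  field_simp
  ring

theorem prod_smoothedPointMass_zero {q n : ℕ} (y z : Fin n → Fin q) :
    ∏ i, smoothedPointMass 0 (y i) (z i) = if z = y then 1 else 0 := by
  simp only [smoothedPointMass, sub_zero, one_mul, zero_div, add_zero]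
  rw [Finset.prod_ite_zero, Finset.prod_const_one]
  simp [funext_iff, eq_comm]

theorem IsProductDist.sum_eq_one {N : ℕ} {X : Fin N → Type*} [∀ i, Fintype (X i)]
    {p : ((i : Fin N) → X i) → ℝ} (hp : IsProductDist p) : ∑ x, p x = 1 := by
  obtain ⟨f, hf, hpf⟩ := hp
  classical
  simp_rw [hpf]
  rw [← Fintype.prod_sum]
  exact Finset.prod_eq_one fun i _ => (hf i).2

open Filter Topology Matrix in
/-- A positive function on `{0,…,q-1}^(n+1)` is a positive combination of `q^n` strictly positive
product distributions. -/
theorem exists_pos_combination_productDist {q n : ℕ} [NeZero q]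
    {p : (Fin (n + 1) → Fin q) → ℝ} (hpos : ∀ x, 0 < p x) :
    ∃ (α : (Fin n → Fin q) → ℝ) (f : (Fin n → Fin q) → (Fin (n + 1) → Fin q) → ℝ),
      (∀ y, 0 < α y) ∧ (∀ y, IsProductDist (f y)) ∧ (∀ y x, 0 < f y x) ∧
      ∀ x, p x = ∑ y, α y * f y x := by
  let M : ℝ → Matrix (Fin n → Fin q) (Fin n → Fin q) ℝ := fun ε =>
    Matrix.of fun z y => ∏ i, smoothedPointMass ε (y i) (z i)
  have hM : Continuous M := by
    refine continuous_matrix fun z y => ?_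
    simp only [M, Matrix.of_apply, smoothedPointMass]
    fun_prop
  have hM0 : M 0 = 1 := by
    ext z y
    simp only [M, Matrix.of_apply, prod_smoothedPointMass_zero, Matrix.one_apply]
  have hev : ∀ᶠ ε in 𝓝[>] (0 : ℝ), ∀ k : Fin q, ∃ g : (Fin n → Fin q) → ℝ,
      (∀ y, 0 < g y) ∧ M ε *ᵥ g = fun z => p (Fin.cons k z) :=
    (eventually_all.2 fun k => Matrix.eventually_exists_pos_mulVec_eq hM hM0
      fun z => hpos (Fin.cons k z)).filter_mono nhdsWithin_le_nhds
  obtain ⟨ε, hg, hε₀, hε₁⟩ :=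
    (hev.and (Ioo_mem_nhdsGT (zero_lt_one' ℝ))).exists
  choose g hgpos hgM using hg
  have hα : ∀ y, 0 < ∑ k, g k y := fun y =>
    Finset.sum_pos (fun k _ => hgpos k y) Finset.univ_nonempty
  refine ⟨fun y => ∑ k, g k y, fun y x => g (x 0) y / (∑ k, g k y) *
    ∏ i : Fin n, smoothedPointMass ε (y i) (x i.succ), hα, fun y => ?_, fun y x => ?_, fun x => ?_⟩
  · refine ⟨Fin.cons (fun b => g b y / ∑ k, g k y) fun i => smoothedPointMass ε (y i),
      Fin.forall_fin_succ.2 ⟨?_, fun i => ?_⟩, fun x => ?_⟩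
    · refine ⟨fun b => (div_pos (hgpos b y) (hα y)).le, ?_⟩
      simp only [Fin.cons_zero]
      rw [← Finset.sum_div, div_self (hα y).ne']
    · exact ⟨fun b => (smoothedPointMass_pos hε₀ hε₁ _ _).le, sum_smoothedPointMass _ _⟩
    · simp [Fin.prod_univ_succ]
  · exact mul_pos (div_pos (hgpos _ _) (hα y))
      (Finset.prod_pos fun i _ => smoothedPointMass_pos hε₀ hε₁ _ _)
  · have h := congrFun (hgM (x 0)) (Fin.tail x)
    simp only [Fin.cons_self_tail] at h
    rw [← h]
    simp only [Matrix.mulVec, dotProduct, M, Matrix.of_apply, Fin.tail]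
    refine Finset.sum_congr rfl fun y _ => ?_
    have := (hα y).ne'
    field_simp

/-- if `m ≥ q^(N-1)`, every strictly positive distribution on
`{0,…,q-1}^N` is a mixture of `m` strictly positive product distributions. -/
theorem stmt_0 (q N m : ℕ) (hq : 2 ≤ q) (hN : 1 ≤ N) (hm : q ^ (N - 1) ≤ m)
    (p : (Fin N → Fin q) → ℝ) (hp : IsDist p) (hpos : ∀ x, 0 < p x) :
    ∃ (α : Fin m → ℝ) (f : Fin m → (Fin N → Fin q) → ℝ),
      (∀ i, 0 ≤ α i) ∧ ∑ i, α i = 1 ∧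
      (∀ i, IsProductDist (f i)) ∧ (∀ i x, 0 < f i x) ∧
      ∀ x, p x = ∑ i, α i * f i x := by
  obtain ⟨n, rfl⟩ : ∃ n, N = n + 1 := ⟨N - 1, by omega⟩
  have : NeZero q := ⟨by omega⟩
  obtain ⟨α, f, hα, hf, hfpos, hpf⟩ := exists_pos_combination_productDist hpos
  obtain ⟨e⟩ : Nonempty ((Fin n → Fin q) ↪ Fin m) :=
    Function.Embedding.nonempty_of_card_le (by simpa using hm)
  have hs : ∀ y, Function.invFun e (e y) = y := Function.leftInverse_invFun e.injective
  set s := Function.invFun e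
  have hsum : ∀ F : (Fin n → Fin q) → ℝ,
      ∑ j, (if e (s j) = j then α (s j) else 0) * F (s j) = ∑ y, α y * F y := by
    intro F
    refine (Finset.sum_of_injOn e e.injective.injOn (by simp) (fun j _ hj => ?_)
      fun y _ => by simp [hs]).symm
    rw [if_neg, zero_mul]
    exact fun h => hj ⟨s j, by simp, h⟩
  refine ⟨fun j => if e (s j) = j then α (s j) else 0, fun j => f (s j), fun j => ?_, ?_,
    fun j => hf _, fun j => hfpos _, fun x => ?_⟩
  · dsimp only
    split_ifs
    exacts [(hα _).le, le_rfl]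
  · have h := hsum fun _ => 1
    simp only [mul_one] at h
    rw [h, ← hp.2]
    simp_rw [hpf]
    rw [Finset.sum_comm]
    simp_rw [← Finset.mul_sum, (hf _).sum_eq_one, mul_one]
  · rw [hpf x, hsum fun y => f y x]
end

section
/- Let q ≥ 2 and N ≥ 1, and let X = {0,…,q−1}^N. Suppose m is such that every strictly positive probability distribution on X can be written as ∑_{i=1}^m α_i f_i with each f_i a product distribution on X, each α_i ≥ 0 and ∑_{i=1}^m α_i = 1. Then m ≥ |C| for every code C ⊆ X whose distinct elements have pairwise Hamming distance at least 2. In particular, if q is a prime power then m ≥ q^{N−1}. -/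
/-- Swapping one coordinate between two points preserves the product of the values of a product
distribution. -/
theorem IsProductDist.mul_eq_mul_update {N : ℕ} {X : Fin N → Type*} [∀ i, Fintype (X i)]
    {p : ((i : Fin N) → X i) → ℝ} (hp : IsProductDist p) (x y : (i : Fin N) → X i) (i : Fin N) :
    p x * p y = p (Function.update x i (y i)) * p (Function.update y i (x i)) := by
  obtain ⟨f, -, hf⟩ := hp
  simp only [hf, ← Finset.prod_mul_distrib]
  refine Finset.prod_congr rfl fun j _ => ?_
  by_cases h : j = i
  · subst h
    simp [mul_comm]
  · simp [Function.update_of_ne h]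

theorem IsProductDist.nonneg {N : ℕ} {X : Fin N → Type*} [∀ i, Fintype (X i)]
    {p : ((i : Fin N) → X i) → ℝ} (hp : IsProductDist p) (x : (i : Fin N) → X i) : 0 ≤ p x := by
  obtain ⟨f, hd, hf⟩ := hp
  rw [hf]
  exact Finset.prod_nonneg fun i _ => (hd i).1 _

theorem hammingDist_update_le_one {ι : Type*} [Fintype ι] [DecidableEq ι] {X : ι → Type*}
    [∀ i, DecidableEq (X i)] (x : (i : ι) → X i) (i : ι) (a : X i) :
    hammingDist x (Function.update x i a) ≤ 1 := by
  unfold hammingDist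
  refine (Finset.card_le_card (t := {i}) fun j hj => ?_).trans (Finset.card_singleton i).le
  by_contra h
  simp only [Finset.mem_singleton] at h
  simp [Function.update_of_ne h] at hj

theorem update_notMem_of_two_le_hammingDist {ι : Type*} [Fintype ι] [DecidableEq ι] {X : ι → Type*}
    [∀ i, DecidableEq (X i)] {C : Finset ((i : ι) → X i)}
    (hC : ∀ x ∈ C, ∀ y ∈ C, x ≠ y → 2 ≤ hammingDist x y) {x : (i : ι) → X i} (hx : x ∈ C)
    {i : ι} {a : X i} (ha : x i ≠ a) : Function.update x i a ∉ C := by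
  intro h
  have hne : x ≠ Function.update x i a := fun he => ha (by simpa using congrFun he i)
  have := hC x hx _ h hne
  have := hammingDist_update_le_one x i a
  omega

/-- If all strictly positive distributions are mixtures of `m` product distributions, then codes of
minimum distance two have at most `m` elements: test the mixture on the distribution proportional
to `m + 1` on the code and to `1` off it. -/
theorem card_le_of_mixture {N m : ℕ} {X : Fin N → Type*} [∀ i, Fintype (X i)]
    [∀ i, DecidableEq (X i)]
    (hmix : ∀ p : ((i : Fin N) → X i) → ℝ, IsDist p → (∀ x, 0 < p x) →
      ∃ (α : Fin m → ℝ) (f : Fin m → ((i : Fin N) → X i) → ℝ),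
        (∀ i, 0 ≤ α i) ∧ ∑ i, α i = 1 ∧ (∀ i, IsProductDist (f i)) ∧
        ∀ x, p x = ∑ i, α i * f i x)
    (C : Finset ((i : Fin N) → X i))
    (hC : ∀ x ∈ C, ∀ y ∈ C, x ≠ y → 2 ≤ hammingDist x y) : C.card ≤ m := by
  rcases C.eq_empty_or_nonempty with rfl | ⟨c, hc⟩
  · simp
  let w : ((i : Fin N) → X i) → ℝ := fun x => if x ∈ C then (m : ℝ) + 1 else 1
  have hw : ∀ x, 0 < w x := fun x => by
    dsimp only [w]
    split_ifs <;> positivity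
  have hZ : 0 < ∑ x, w x := Finset.sum_pos (fun x _ => hw x) ⟨c, Finset.mem_univ c⟩
  set Z := ∑ x, w x
  obtain ⟨α, f, hα, -, hf, hsum⟩ := hmix (fun x => w x / Z)
    ⟨fun x => (div_pos (hw x) hZ).le, by rw [← Finset.sum_div, div_self hZ.ne']⟩
    (fun x => div_pos (hw x) hZ)
  have hnn : ∀ k x, 0 ≤ α k * f k x := fun k x => mul_nonneg (hα k) ((hf k).nonneg x)
  have hoff : ∀ k, ∀ x ∉ C, α k * f k x ≤ 1 / Z := fun k x hx => by
    have h1 := hsum x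
    simp only [w, if_neg hx] at h1
    rw [h1]
    exact Finset.single_le_sum (f := fun k => α k * f k x) (fun j _ => hnn j x)
      (Finset.mem_univ k)
  have hlarge : ∀ x ∈ C, ∃ k, 1 / Z < α k * f k x := fun x hx => by
    by_contra! h
    have h1 := hsum x
    simp only [w, if_pos hx] at h1
    have h2 : ∑ k, α k * f k x ≤ m * (1 / Z) := by
      simpa using Finset.sum_le_sum fun k (_ : k ∈ Finset.univ) => h k
    have h3 : 0 < 1 / Z := by positivity
    rw [← h1, add_div, ← mul_one_div] at h2
    linarith
  have : Nonempty (Fin m) := (hlarge c hc).nonempty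
  choose! g hg using hlarge
  have hinj : Set.InjOn g C := by
    intro x hx y hy hxy
    by_contra hne
    obtain ⟨i, hi⟩ := Function.ne_iff.mp hne
    have hx' := hoff (g x) _ (update_notMem_of_two_le_hammingDist hC hx hi)
    have hy' := hoff (g x) _ (update_notMem_of_two_le_hammingDist hC hy hi.symm)
    have hgx := hg x hx
    have hgy := hg y hy
    rw [← hxy] at hgy
    have h3 : 0 < 1 / Z := by positivity
    have hlt := mul_lt_mul'' hgx hgy h3.le h3.le
    have hle := mul_le_mul hx' hy' (hnn _ _) h3.le
    rw [mul_mul_mul_comm, (hf (g x)).mul_eq_mul_update x y i, ← mul_mul_mul_comm] at hlt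
    linarith
  simpa using Finset.card_le_card_of_injOn g (t := Finset.univ) (fun _ _ => Finset.mem_univ _) hinj

/-- Distinct words with the same coordinate sum are at Hamming distance at least two. -/
theorem two_le_hammingDist_of_sum_eq {ι G : Type*} [Fintype ι] [DecidableEq G]
    [AddCommGroup G] {x y : ι → G} (h : ∑ i, x i = ∑ i, y i) (hne : x ≠ y) :
    2 ≤ hammingDist x y := by
  classical
  by_contra! hlt
  obtain ⟨i, hi⟩ := Function.ne_iff.mp hne
  have hoff : ∀ j, j ≠ i → x j = y j := fun j hj => by
    by_contra hxy
    exact hj (Finset.card_le_one.mp (Nat.lt_succ_iff.mp hlt) j (by simpa using hxy) i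
      (by simpa using hi))
  rw [← Finset.add_sum_erase _ _ (Finset.mem_univ i),
    ← Finset.add_sum_erase _ y (Finset.mem_univ i),
    Finset.sum_congr rfl fun j hj => hoff j (Finset.ne_of_mem_erase hj)] at h
  exact hi (add_right_cancel h)

/-- The zero-sum code of length `n + 1` has minimum distance two and `|G| ^ n` words. -/
theorem exists_code_card_eq_pow (G : Type*) [Fintype G] [DecidableEq G] [AddCommGroup G] (n : ℕ) :
    ∃ C : Finset (Fin (n + 1) → G),
      (∀ x ∈ C, ∀ y ∈ C, x ≠ y → 2 ≤ hammingDist x y) ∧ C.card = Fintype.card G ^ n := by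
  let e : (Fin n → G) → Fin (n + 1) → G := fun y => Fin.cons (-∑ i, y i) y
  have he : Function.Injective e := fun y z h => (Fin.cons_injective2 h).2
  have hsum : ∀ y, ∑ i, e y i = 0 := fun y => by simp [e, Fin.sum_univ_succ]
  refine ⟨Finset.univ.image e, ?_, ?_⟩
  · simp only [Finset.mem_image, Finset.mem_univ, true_and]
    rintro _ ⟨y, rfl⟩ _ ⟨z, rfl⟩ hne
    exact two_le_hammingDist_of_sum_eq ((hsum y).trans (hsum z).symm) hne
  · simp [Finset.card_image_of_injective _ he]

/-- if every strictly positive distribution on `{0,…,q-1}^N` is a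
mixture of `m` product distributions, then `m ≥ |C|` for every code `C` of
minimum Hamming distance `2`; in particular `m ≥ q^(N-1)` when `q` is a prime
power. -/
theorem stmt_1 (q N m : ℕ) (hq : 2 ≤ q) (hN : 1 ≤ N)
    (hmix : ∀ p : (Fin N → Fin q) → ℝ, IsDist p → (∀ x, 0 < p x) →
      ∃ (α : Fin m → ℝ) (f : Fin m → (Fin N → Fin q) → ℝ),
        (∀ i, 0 ≤ α i) ∧ ∑ i, α i = 1 ∧ (∀ i, IsProductDist (f i)) ∧
        ∀ x, p x = ∑ i, α i * f i x) :
    (∀ C : Finset (Fin N → Fin q),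
      (∀ x ∈ C, ∀ y ∈ C, x ≠ y → 2 ≤ hammingDist x y) → C.card ≤ m) ∧
    (IsPrimePow q → q ^ (N - 1) ≤ m) := by
  have hcode := card_le_of_mixture hmix
  refine ⟨hcode, fun _ => ?_⟩
  have : NeZero q := ⟨by omega⟩
  obtain ⟨n, rfl⟩ : ∃ n, N = n + 1 := ⟨N - 1, by omega⟩
  obtain ⟨C, hC, hcard⟩ := exists_code_card_eq_pow (Fin q) n
  simpa [hcard] using hcode C hC
end

section
/- Let X = X_1 × ⋯ × X_N with each X_i a finite nonempty set, and let m be a natural number with m · max_{i∈{1,…,N}} |X_i| ≥ |X|. Then every strictly positive probability distribution on X can be written as a convex combination of m strictly positive product distributions on X. -/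
/-- Mixing the point mass at `b` with the uniform distribution. -/
noncomputable def mixedPointMass {Y : Type*} [Fintype Y] [DecidableEq Y] (ε : ℝ) (b z : Y) : ℝ :=
  (1 - ε) * (if b = z then 1 else 0) + ε * (Fintype.card Y : ℝ)⁻¹

/-- The entries of the inverse of the matrix `mixedPointMass ε`. -/
noncomputable def mixedPointMassInv {Y : Type*} [Fintype Y] [DecidableEq Y] (ε : ℝ) (b a : Y) : ℝ :=
  ((if b = a then 1 else 0) - ε * (Fintype.card Y : ℝ)⁻¹) / (1 - ε)

theorem mixedPointMass_pos {Y : Type*} [Fintype Y] [DecidableEq Y] {ε : ℝ} (h0 : 0 < ε)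
    (h1 : ε < 1) (b z : Y) : 0 < mixedPointMass ε b z := by
  have : Nonempty Y := ⟨b⟩
  have hc : (0 : ℝ) < Fintype.card Y := by exact_mod_cast Fintype.card_pos
  have h2 : 0 < 1 - ε := by linarith
  unfold mixedPointMass
  split_ifs <;> positivity

theorem sum_mixedPointMass {Y : Type*} [Fintype Y] [DecidableEq Y] (ε : ℝ) (b : Y) :
    ∑ z, mixedPointMass ε b z = 1 := by
  have : Nonempty Y := ⟨b⟩
  have hc : (Fintype.card Y : ℝ) ≠ 0 := by exact_mod_cast Fintype.card_ne_zero
  simp only [mixedPointMass, Finset.sum_add_distrib, ← Finset.mul_sum, Finset.sum_ite_eq,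
    Finset.mem_univ, if_true, Finset.sum_const, Finset.card_univ, nsmul_eq_mul]
  field_simp
  ring

theorem sum_mixedPointMass_mul_inv {Y : Type*} [Fintype Y] [DecidableEq Y] {ε : ℝ} (h1 : ε < 1)
    (z a : Y) :
    ∑ b, mixedPointMass ε b z * mixedPointMassInv ε b a = if z = a then 1 else 0 := by
  have : Nonempty Y := ⟨a⟩
  have hc : (Fintype.card Y : ℝ) ≠ 0 := by exact_mod_cast Fintype.card_ne_zero
  have h2 : 1 - ε ≠ 0 := by linarith
  have key : ∀ b : Y, mixedPointMass ε b z * mixedPointMassInv ε b a =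
      (if b = z then (if z = a then 1 else 0) - ε * (Fintype.card Y : ℝ)⁻¹ else 0) +
      (if b = a then ε * (Fintype.card Y : ℝ)⁻¹ / (1 - ε) else 0) -
      ε * (Fintype.card Y : ℝ)⁻¹ * (ε * (Fintype.card Y : ℝ)⁻¹) / (1 - ε) := by
    intro b
    unfold mixedPointMass mixedPointMassInv
    by_cases hz : b = z
    · subst hz
      by_cases ha : b = a <;> simp [ha] <;> field_simp <;> ring
    · simp only [hz, if_false]
      by_cases ha : b = a <;> simp only [ha, if_true, if_false] <;> field_simp <;> ring
  simp only [key, Finset.sum_add_distrib, Finset.sum_sub_distrib, Finset.sum_ite_eq',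
    Finset.mem_univ, if_true, Finset.sum_const, Finset.card_univ, nsmul_eq_mul]
  field_simp
  ring

/-- A positive function on `(∏ i, Y i) × Z` is a combination, with positive coefficient functions
on `Z`, of strictly positive product distributions on `∏ i, Y i`, one for each point. -/
theorem exists_pos_eq_sum_prod {ι : Type*} [Fintype ι] [DecidableEq ι] {Y : ι → Type*}
    [∀ i, Fintype (Y i)] {Z : Type*} [Fintype Z]
    (P : ((i : ι) → Y i) → Z → ℝ) (hP : ∀ y x, 0 < P y x) :
    ∃ (u : (i : ι) → Y i → Y i → ℝ) (G : ((i : ι) → Y i) → Z → ℝ),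
      (∀ i b, IsDist (u i b)) ∧ (∀ i b z, 0 < u i b z) ∧ (∀ y x, 0 < G y x) ∧
      ∀ z x, P z x = ∑ b, (∏ i, u i (b i) (z i)) * G b x := by
  classical
  have hG : ∀ᶠ ε : ℝ in nhds 0, ∀ (b : (i : ι) → Y i) x,
      0 < ∑ y, (∏ i, mixedPointMassInv ε (b i) (y i)) * P y x := by
    simp only [Filter.eventually_all]
    intro b x
    have hcont : ContinuousAt
        (fun ε : ℝ => ∑ y, (∏ i, mixedPointMassInv ε (b i) (y i)) * P y x) 0 := by
      unfold mixedPointMassInv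
      fun_prop (disch := norm_num)
    refine hcont.eventually_const_lt ?_
    have : ∀ y, (∏ i, mixedPointMassInv 0 (b i) (y i)) = if b = y then 1 else 0 := by
      intro y
      simp [mixedPointMassInv, Finset.prod_ite_zero, funext_iff]
    simpa [this] using hP b x
  obtain ⟨ε, hpos, h0, h1⟩ : ∃ ε : ℝ,
      (∀ (b : (i : ι) → Y i) x, 0 < ∑ y, (∏ i, mixedPointMassInv ε (b i) (y i)) * P y x) ∧ 0 < ε ∧ ε < 1 :=
    ((hG.filter_mono nhdsWithin_le_nhds).and (Ioo_mem_nhdsGT one_pos)).exists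
  refine ⟨fun _ => mixedPointMass ε, _,
    fun i b => ⟨fun z => (mixedPointMass_pos h0 h1 b z).le, sum_mixedPointMass ε b⟩,
    fun i => mixedPointMass_pos h0 h1, hpos, fun z x => ?_⟩
  have hinv : ∀ y : (i : ι) → Y i, ∑ b : (i : ι) → Y i, (∏ i, mixedPointMass ε (b i) (z i)) *
      ∏ i, mixedPointMassInv ε (b i) (y i) = if z = y then 1 else 0 := by
    intro y
    simp only [← Finset.prod_mul_distrib]
    rw [← Fintype.prod_sum fun i b => mixedPointMass ε b (z i) * mixedPointMassInv ε b (y i)]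
    simp [sum_mixedPointMass_mul_inv h1, Finset.prod_ite_zero, funext_iff]
  simp only [Finset.mul_sum]
  rw [Finset.sum_comm]
  simp only [← mul_assoc, ← Finset.sum_mul, hinv]
  simp

/-- A convex combination indexed by `ι` can be padded with zero weights to one indexed
by `Fin m`. -/
theorem exists_convex_combination_fin {ι Ω : Type*} [Fintype ι] [Nonempty ι] {m : ℕ}
    (hm : Fintype.card ι ≤ m) (C : (Ω → ℝ) → Prop) (p : Ω → ℝ) (β : ι → ℝ) (F : ι → Ω → ℝ)
    (hβ : ∀ i, 0 ≤ β i) (hsum : ∑ i, β i = 1) (hF : ∀ i, C (F i))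
    (hp : ∀ x, p x = ∑ i, β i * F i x) :
    ∃ (α : Fin m → ℝ) (f : Fin m → Ω → ℝ),
      (∀ i, 0 ≤ α i) ∧ ∑ i, α i = 1 ∧ (∀ i, C (f i)) ∧ ∀ x, p x = ∑ i, α i * f i x := by
  obtain ⟨s⟩ : Nonempty (ι ↪ Fin m) := by
    rw [Function.Embedding.nonempty_iff_card_le]
    simpa using hm
  obtain ⟨i₀⟩ := ‹Nonempty ι›
  refine ⟨Function.extend s β 0, Function.extend s F fun _ => F i₀, fun j => ?_, ?_,
    fun j => ?_, fun x => ?_⟩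
  · by_cases h : ∃ a, s a = j
    · obtain ⟨a, rfl⟩ := h
      simpa [s.injective.extend_apply] using hβ a
    · simp [Function.extend_apply' _ _ _ h]
  · rw [← hsum]
    refine (Fintype.sum_of_injective s s.injective _ _ (fun j h => ?_) fun a => ?_).symm
    · simp [Function.extend_apply' _ _ _ h]
    · simp [s.injective.extend_apply]
  · by_cases h : ∃ a, s a = j
    · obtain ⟨a, rfl⟩ := h
      simpa [s.injective.extend_apply] using hF a
    · simpa [Function.extend_apply' _ _ _ h] using hF i₀
  · rw [hp]
    refine Fintype.sum_of_injective s s.injective _ _ (fun j h => ?_) fun a => ?_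
    · simp [Function.extend_apply' _ _ _ h]
    · simp [s.injective.extend_apply]

/-- if `m · max_i |X_i| ≥ |X|`, then every strictly positive
distribution on `X = X_1 × ⋯ × X_N` is a convex combination of `m` strictly
positive product distributions. -/
theorem stmt_2 (N m : ℕ) (X : Fin N → Type*) [∀ i, Fintype (X i)]
    [∀ i, Nonempty (X i)]
    (hm : Fintype.card ((i : Fin N) → X i) ≤
      m * Finset.univ.sup (fun i : Fin N => Fintype.card (X i)))
    (p : ((i : Fin N) → X i) → ℝ) (hp : IsDist p) (hpos : ∀ x, 0 < p x) :
    ∃ (α : Fin m → ℝ) (f : Fin m → ((i : Fin N) → X i) → ℝ),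
      (∀ i, 0 ≤ α i) ∧ ∑ i, α i = 1 ∧
      (∀ i, IsProductDist (f i)) ∧ (∀ i x, 0 < f i x) ∧
      ∀ x, p x = ∑ i, α i * f i x := by
  cases N with
  | zero => simp at hm
  | succ n =>
  obtain ⟨k, -, hk⟩ := Finset.exists_mem_eq_sup Finset.univ Finset.univ_nonempty
    fun i => Fintype.card (X i)
  have hcard : Fintype.card ((i : Fin n) → X (k.succAbove i)) ≤ m := by
    rw [hk, Fintype.card_pi, Fin.prod_univ_succAbove _ k, mul_comm] at hm
    rw [Fintype.card_pi]
    exact le_of_mul_le_mul_right hm Fintype.card_pos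
  obtain ⟨u, G, hu, hupos, hGpos, hG⟩ := exists_pos_eq_sum_prod
    (fun (y : (i : Fin n) → X (k.succAbove i)) (x : X k) => p (k.insertNth x y))
    fun y x => hpos _
  have hSpos : ∀ b, 0 < ∑ x, G b x := fun b =>
    Finset.sum_pos (fun x _ => hGpos b x) Finset.univ_nonempty
  have hsum : ∑ b, ∑ x, G b x = 1 := by
    rw [← hp.2, ← (Fin.insertNthEquiv X k).sum_comp, Fintype.sum_prod_type, Finset.sum_comm]
    refine Finset.sum_congr rfl fun x _ => ?_
    change _ = ∑ y, p (k.insertNth x y)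
    simp only [hG]
    rw [Finset.sum_comm]
    refine Finset.sum_congr rfl fun b _ => ?_
    rw [← Finset.sum_mul, ← Fintype.prod_sum fun i z => u i (b i) z]
    simp [(hu _ _).2]
  have hF : ∀ b, IsProductDist (fun x : (i : Fin (n + 1)) → X i =>
      (G b (x k) / ∑ x, G b x) * ∏ i, u i (b i) (x (k.succAbove i))) := by
    refine fun b => ⟨k.insertNth (α := fun i => X i → ℝ) (fun x => G b x / ∑ x, G b x)
      fun i => u i (b i), ?_, fun x => by simp [Fin.prod_univ_succAbove _ k]⟩
    rw [Fin.forall_iff_succAbove k]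
    refine ⟨?_, fun i => by simpa using hu i (b i)⟩
    rw [Fin.insertNth_apply_same]
    refine ⟨fun x => (div_pos (hGpos b x) (hSpos b)).le, ?_⟩
    rw [← Finset.sum_div, div_self (hSpos b).ne']
  have hp_eq : ∀ x, p x = ∑ b, (∑ x, G b x) *
      ((G b (x k) / ∑ x, G b x) * ∏ i, u i (b i) (x (k.succAbove i))) := by
    intro x
    have := hG (fun i => x (k.succAbove i)) (x k)
    rw [show k.insertNth (x k) (fun i => x (k.succAbove i)) = x from
      Fin.insertNth_self_removeNth k x] at this
    rw [this]
    refine Finset.sum_congr rfl fun b _ => ?_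
    rw [← mul_assoc, mul_div_cancel₀ _ (hSpos b).ne', mul_comm]
  obtain ⟨α, f, h1, h2, h3, h4⟩ := exists_convex_combination_fin hcard
    (fun q => IsProductDist q ∧ ∀ x, 0 < q x) p (fun b => ∑ x, G b x) _
    (fun b => (hSpos b).le) hsum
    (fun b => ⟨hF b, fun x => mul_pos (div_pos (hGpos _ _) (hSpos b))
      (Finset.prod_pos fun i _ => hupos _ _ _)⟩) hp_eq
  exact ⟨α, f, h1, h2, fun i => (h3 i).1, fun i => (h3 i).2, h4⟩
end

section
/- Let p be a probability distribution on {0,1}^N whose support is contained in a union of κ edges of the N-cube; that is, there are κ pairs of binary vectors, each pair differing in exactly one coordinate, whose union contains supp(p). Then p can be written as a convex combination of κ product distributions on {0,1}^N. -/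
/-- A distribution supported on a line parallel to the `i`-th coordinate axis is a product
distribution. -/
theorem IsDist.isProductDist_of_support_line {N : ℕ} {X : Fin N → Type*} [∀ i, Fintype (X i)]
    [∀ i, DecidableEq (X i)] {q : ((i : Fin N) → X i) → ℝ} (hq : IsDist q)
    (a : (i : Fin N) → X i) (i : Fin N)
    (hline : ∀ x, q x ≠ 0 → x = Function.update a i (x i)) : IsProductDist q := by
  classical
  refine ⟨fun k t => if k = i then q (Function.update a k t) else if t = a k then 1 else 0,
    fun k => ⟨fun t => ?_, ?_⟩, fun x => ?_⟩
  · dsimp only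
    split_ifs
    exacts [hq.1 _, zero_le_one, le_rfl]
  · by_cases hk : k = i
    · subst hk
      simp only [if_true]
      rw [← hq.2]
      refine Fintype.sum_of_injective (Function.update a k) (Function.update_injective a k) _ _
        (fun x hx => ?_) fun _ => rfl
      by_contra h
      exact hx ⟨x k, (hline x h).symm⟩
    · simp [hk]
  · rw [← Finset.mul_prod_erase _ _ (Finset.mem_univ i)]
    simp only [if_true]
    by_cases hx : x = Function.update a i (x i)
    · rw [← hx, Finset.prod_eq_one, mul_one]
      intro k hk
      have hki := Finset.ne_of_mem_erase hk
      rw [if_neg hki, if_pos]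
      rw [hx, Function.update_of_ne hki]
    · have hqx : q x = 0 := by
        by_contra h
        exact hx (hline x h)
      obtain ⟨k, hk⟩ := Function.ne_iff.mp hx
      have hki : k ≠ i := by
        rintro rfl
        simp at hk
      rw [Function.update_of_ne hki] at hk
      rw [hqx, Finset.prod_eq_zero (Finset.mem_erase.mpr ⟨hki, Finset.mem_univ k⟩), mul_zero]
      rw [if_neg hki, if_neg hk]

/-- Two points at Hamming distance one lie on a line parallel to a coordinate axis. -/
theorem exists_eq_update_of_hammingDist_eq_one {ι : Type*} [Fintype ι] [DecidableEq ι]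
    {X : ι → Type*} [∀ i, DecidableEq (X i)] {a b : (i : ι) → X i} (h : hammingDist a b = 1) :
    ∃ i, b = Function.update a i (b i) := by
  obtain ⟨i, hi⟩ := Finset.card_eq_one.mp h
  refine ⟨i, funext fun k => ?_⟩
  by_cases hk : k = i
  · subst hk
    simp
  · rw [Function.update_of_ne hk]
    by_contra hne
    have hmem : k ∈ Finset.univ.filter fun j => a j ≠ b j := by simpa using Ne.symm hne
    rw [hi] at hmem
    exact hk (Finset.mem_singleton.mp hmem)

/-- a distribution on `{0,1}^N` whose support is contained in a
union of `κ` edges of the `N`-cube is a convex combination of `κ` product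
distributions. -/
theorem stmt_3 (N κ : ℕ) (p : (Fin N → Fin 2) → ℝ) (hp : IsDist p)
    (a b : Fin κ → (Fin N → Fin 2))
    (hedge : ∀ j, hammingDist (a j) (b j) = 1)
    (hcover : ∀ x, 0 < p x → ∃ j, x = a j ∨ x = b j) :
    ∃ (α : Fin κ → ℝ) (f : Fin κ → (Fin N → Fin 2) → ℝ),
      (∀ i, 0 ≤ α i) ∧ ∑ i, α i = 1 ∧ (∀ i, IsProductDist (f i)) ∧
      ∀ x, p x = ∑ i, α i * f i x := by
  classical
  obtain ⟨x₀, hx₀⟩ : ∃ x, 0 < p x := by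
    by_contra! h
    have := hp.2 ▸ Finset.sum_nonpos fun x _ => h x
    exact absurd this (by norm_num)
  obtain ⟨j₀, -⟩ := hcover x₀ hx₀
  have hchoice : ∀ x, ∃ j, 0 < p x → x = a j ∨ x = b j := fun x => by
    by_cases h : 0 < p x
    · exact (hcover x h).imp fun j hj _ => hj
    · exact ⟨j₀, fun h' => absurd h' h⟩
  choose c hc using hchoice
  choose i hi using fun j => exists_eq_update_of_hammingDist_eq_one (hedge j)
  let q : Fin κ → (Fin N → Fin 2) → ℝ := fun j x => if c x = j then p x else 0
  have hq : ∀ j x, 0 ≤ q j x := fun j x => by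
    dsimp only [q]
    split_ifs
    exacts [hp.1 x, le_rfl]
  have hqsum : ∀ x, ∑ j, q j x = p x := fun x => by simp [q]
  have hqline : ∀ j x, q j x ≠ 0 → x = Function.update (a j) (i j) (x (i j)) := by
    intro j x h
    obtain ⟨rfl, hpx⟩ : c x = j ∧ p x ≠ 0 := by simpa [q] using h
    rcases hc x (lt_of_le_of_ne (hp.1 x) hpx.symm) with h | h
    · conv_lhs => rw [h]
      rw [congrFun h, Function.update_eq_self]
    · conv_lhs => rw [h, hi]
      rw [congrFun h]
  let α : Fin κ → ℝ := fun j => ∑ x, q j x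
  have hα : ∀ j, 0 ≤ α j := fun j => Finset.sum_nonneg fun x _ => hq j x
  refine ⟨α, fun j x => if α j = 0 then (if x = a j then 1 else 0) else q j x / α j, hα, ?_,
    fun j => ?_, fun x => ?_⟩
  · rw [Finset.sum_comm, ← hp.2]
    exact Finset.sum_congr rfl fun x _ => hqsum x
  · by_cases h : α j = 0
    · simp only [h, if_true]
      refine IsDist.isProductDist_of_support_line ⟨fun x => ?_, by simp⟩ (a j) (i j) fun x hx => ?_
      · dsimp only
        split_ifs
        exacts [zero_le_one, le_rfl]
      · obtain rfl : x = a j := by simpa using hx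
        simp
    · simp only [h, if_false]
      refine IsDist.isProductDist_of_support_line (q := fun x => q j x / α j)
        ⟨fun x => div_nonneg (hq j x) (hα j), ?_⟩
        (a j) (i j) fun x hx => hqline j x fun h0 => hx (by simp only [h0, zero_div])
      rw [← Finset.sum_div]
      exact div_self h
  · rw [← hqsum x]
    refine Finset.sum_congr rfl fun j _ => ?_
    by_cases h : α j = 0
    · rw [h, zero_mul]
      exact (Finset.sum_eq_zero_iff_of_nonneg fun x _ => hq j x).mp h x (Finset.mem_univ x)
    · simp only [h, if_false]
      rw [mul_div_cancel₀ _ h]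
end

section
/- Let p be a probability distribution on {0,1}^N with supp(p) ⊆ Z_+ (or supp(p) ⊆ Z_−). If p = ∑_{i=1}^m α_i f_i where each f_i is a product distribution on {0,1}^N, each α_i ≥ 0 and ∑_{i=1}^m α_i = 1, then the number of indices i with α_i > 0 and |supp(f_i)| = 1 is at least |supp(p)|; in particular m ≥ |supp(p)|. -/
/-- The set of even-parity binary vectors. -/
def Zplus (N : ℕ) : Set (Fin N → Fin 2) := {x | Even (∑ i, (x i : ℕ))}

/-- The set of odd-parity binary vectors. -/
def Zminus (N : ℕ) : Set (Fin N → Fin 2) := {x | ¬ Even (∑ i, (x i : ℕ))}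

/-- Changing one coordinate of a binary vector changes its parity. -/
theorem even_sum_update_iff {N : ℕ} (x : Fin N → Fin 2) {j : Fin N} {b : Fin 2} (h : x j ≠ b) :
    Even (∑ i, (Function.update x j b i : ℕ)) ↔ ¬ Even (∑ i, (x i : ℕ)) := by
  have hsum : ∑ i ∈ Finset.univ.erase j, (Function.update x j b i : ℕ)
      = ∑ i ∈ Finset.univ.erase j, (x i : ℕ) :=
    Finset.sum_congr rfl fun i hi => by rw [Function.update_of_ne (Finset.ne_of_mem_erase hi)]
  rw [← Finset.add_sum_erase _ _ (Finset.mem_univ j),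
    ← Finset.add_sum_erase _ (fun i => (x i : ℕ)) (Finset.mem_univ j), hsum,
    Function.update_self]
  simp only [Nat.even_iff]
  omega

/-- The support of a product distribution is closed under replacing a coordinate of one of its
points by that of another. -/
theorem IsProductDist.update_pos {N : ℕ} {X : Fin N → Type*} [∀ i, Fintype (X i)]
    {p : ((i : Fin N) → X i) → ℝ} (hp : IsProductDist p) {x y : (i : Fin N) → X i}
    (hx : 0 < p x) (hy : 0 < p y) (j : Fin N) : 0 < p (Function.update x j (y j)) := by
  obtain ⟨f, hf, h⟩ := hp
  have factor_pos : ∀ {z}, 0 < p z → ∀ i, 0 < f i (z i) := fun {z} hz i =>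
    lt_of_le_of_ne ((hf i).1 _) fun h0 =>
      hz.ne' ((h z).trans (Finset.prod_eq_zero (Finset.mem_univ i) h0.symm))
  rw [h]
  refine Finset.prod_pos fun i _ => ?_
  rcases eq_or_ne i j with rfl | hij
  · simpa using factor_pos hy i
  · simpa [hij] using factor_pos hx i

/-- A product distribution whose support has constant parity has at most one point in its
support. -/
theorem IsProductDist.eq_of_pos {N : ℕ} {p : (Fin N → Fin 2) → ℝ} (hp : IsProductDist p)
    (hpar : ∀ x y, 0 < p x → 0 < p y → (Even (∑ i, (x i : ℕ)) ↔ Even (∑ i, (y i : ℕ))))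
    {x y : Fin N → Fin 2} (hx : 0 < p x) (hy : 0 < p y) : x = y := by
  by_contra hne
  obtain ⟨j, hj⟩ := Function.ne_iff.mp hne
  have h := hpar _ _ (hp.update_pos hx hy j) hx
  rw [even_sum_update_iff x hj] at h
  tauto

/-- if a distribution supported in `Z₊` (or `Z₋`) is a mixture of
product distributions, then at least `|supp p|` of the components with positive
weight have singleton support; in particular `m ≥ |supp p|`. -/
theorem stmt_4 (N m : ℕ) (p : (Fin N → Fin 2) → ℝ) (hp : IsDist p)
    (hsupp : {x | 0 < p x} ⊆ Zplus N ∨ {x | 0 < p x} ⊆ Zminus N)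
    (α : Fin m → ℝ) (f : Fin m → (Fin N → Fin 2) → ℝ)
    (hα : ∀ i, 0 ≤ α i) (hs : ∑ i, α i = 1)
    (hf : ∀ i, IsProductDist (f i))
    (heq : ∀ x, p x = ∑ i, α i * f i x) :
    {x | 0 < p x}.ncard ≤
      {i : Fin m | 0 < α i ∧ {x | 0 < f i x}.ncard = 1}.ncard ∧
    {x | 0 < p x}.ncard ≤ m := by
  have hpar : ∀ x y, 0 < p x → 0 < p y →
      (Even (∑ i, (x i : ℕ)) ↔ Even (∑ i, (y i : ℕ))) := by
    intro x y hx hy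
    rcases hsupp with h | h
    · exact iff_of_true (h hx) (h hy)
    · exact iff_of_false (h hx) (h hy)
  have hterm : ∀ i x, 0 ≤ α i * f i x := fun i x => mul_nonneg (hα i) ((hf i).nonneg x)
  have hpos : ∀ i, 0 < α i → ∀ x, 0 < f i x → 0 < p x := by
    intro i hi x hx
    rw [heq]
    exact Finset.sum_pos' (fun k _ => hterm k x) ⟨i, Finset.mem_univ i, mul_pos hi hx⟩
  have huniq : ∀ i, 0 < α i → ∀ x y, 0 < f i x → 0 < f i y → x = y := fun i hi x y hx hy =>
    (hf i).eq_of_pos (fun u v hu hv => hpar u v (hpos i hi u hu) (hpos i hi v hv)) hx hy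
  have hex : ∀ x, 0 < p x → ∃ i, 0 < α i ∧ 0 < f i x := by
    intro x hx
    rw [heq] at hx
    obtain ⟨i, -, hi⟩ := Finset.exists_ne_zero_of_sum_ne_zero hx.ne'
    exact ⟨i, (hα i).lt_of_ne' (left_ne_zero_of_mul hi),
      ((hf i).nonneg x).lt_of_ne' (right_ne_zero_of_mul hi)⟩
  have : Nonempty (Fin m) := by
    by_contra h
    rw [not_nonempty_iff] at h
    simp at hs
  choose! g hgα hgf using hex
  have hle : {x | 0 < p x}.ncard ≤
      {i : Fin m | 0 < α i ∧ {x | 0 < f i x}.ncard = 1}.ncard := by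
    refine Set.ncard_le_ncard_of_injOn g (fun x hx => ⟨hgα x hx, ?_⟩) ?_ (Set.toFinite _)
    · rw [Set.ncard_eq_one]
      exact ⟨x, Set.eq_singleton_iff_unique_mem.mpr
        ⟨hgf x hx, fun y hy => huniq _ (hgα x hx) y x hy (hgf x hx)⟩⟩
    · intro x hx y hy hxy
      exact huniq _ (hgα x hx) x y (hgf x hx) (hxy ▸ hgf y hy)
  refine ⟨hle, hle.trans ?_⟩
  simpa using Set.ncard_le_card {i : Fin m | 0 < α i ∧ {x | 0 < f i x}.ncard = 1}
end

section
/- Let 0 < k < N and let κ = ⌈2^{N−1}/(2^k − 1)⌉ (equivalently, the smallest integer ≥ 2^{N−(k+1)}·(1 + 1/(2^k − 1))). If m ≥ κ, then every strictly positive probability distribution on {0,1}^N can be written as a convex combination of m elements of the k-interaction exponential family E^k on {0,1}^N. -/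
/-- `g` depends only on the coordinates in `s`. -/
def DependsOnlyOn {N : ℕ} {X : Fin N → Type*} (s : Finset (Fin N))
    (g : ((i : Fin N) → X i) → ℝ) : Prop :=
  ∀ x y, (∀ i ∈ s, x i = y i) → g x = g y

/-- The `k`-interaction exponential family on `X = X_1 × ⋯ × X_N`:
distributions `p x = exp (f x) / ∑ y, exp (f y)` where `f` is a sum of terms
each depending on at most `k` coordinates. -/
def interactionFamily (k : ℕ) {N : ℕ} {X : Fin N → Type*} [∀ i, Fintype (X i)] :
    Set (((i : Fin N) → X i) → ℝ) :=
  {p | ∃ F : Finset (Fin N) → ((i : Fin N) → X i) → ℝ,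
    (∀ s, DependsOnlyOn s (F s)) ∧ (∀ s, k < s.card → F s = 0) ∧
    ∀ x, p x = Real.exp (∑ s, F s x) / ∑ y, Real.exp (∑ s, F s y)}

/-- The sums of functions each depending on at most `k` coordinates. -/
def interactionSpace (k : ℕ) {N : ℕ} (X : Fin N → Type*) :
    Submodule ℝ (((i : Fin N) → X i) → ℝ) where
  carrier := {f | ∃ F : Finset (Fin N) → ((i : Fin N) → X i) → ℝ,
    (∀ s, DependsOnlyOn s (F s)) ∧ (∀ s, k < s.card → F s = 0) ∧ f = ∑ s, F s}
  zero_mem' := ⟨0, fun _ _ _ _ => rfl, fun _ _ => rfl, by simp⟩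
  add_mem' := by
    rintro f g ⟨F, hF, hF0, rfl⟩ ⟨G, hG, hG0, rfl⟩
    refine ⟨F + G, fun s x y h => ?_, fun s hs => ?_, by simp [Finset.sum_add_distrib]⟩
    · simp [hF s x y h, hG s x y h]
    · simp [hF0 s hs, hG0 s hs]
  smul_mem' := by
    rintro a f ⟨F, hF, hF0, rfl⟩
    refine ⟨a • F, fun s x y h => ?_, fun s hs => ?_, by simp [Finset.smul_sum]⟩
    · simp [hF s x y h]
    · simp [hF0 s hs]

theorem DependsOnlyOn.mem_interactionSpace {k N : ℕ} {X : Fin N → Type*} {s : Finset (Fin N)}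
    {g : ((i : Fin N) → X i) → ℝ} (hg : DependsOnlyOn s g) (hs : s.card ≤ k) :
    g ∈ interactionSpace k X := by
  classical
  refine ⟨Pi.single s g, fun t => ?_, fun t ht => ?_, by simp⟩
  · rcases eq_or_ne t s with rfl | h
    · simpa using hg
    · rw [Pi.single_eq_of_ne h]
      exact fun _ _ _ => rfl
  · have h : t ≠ s := by
      rintro rfl
      omega
    exact Pi.single_eq_of_ne h _

/-- Normalizing the exponential of an element of the interaction space gives an element of the
interaction family. -/
theorem exp_div_mem_interactionFamily {k N : ℕ} {X : Fin N → Type*} [∀ i, Fintype (X i)]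
    {f : ((i : Fin N) → X i) → ℝ} (hf : f ∈ interactionSpace k X) :
    (fun x => Real.exp (f x) / ∑ y, Real.exp (f y)) ∈ interactionFamily k (X := X) := by
  obtain ⟨F, hF, hF0, rfl⟩ := hf
  exact ⟨F, hF, hF0, fun x => by simp [Finset.sum_apply]⟩

/-- A set `Y` is a simplicial face for the `k`-interactions if it is the zero set of a natural
number valued `k`-interaction and every function on `Y` extends to a `k`-interaction. -/
structure IsSimplicialFace (k : ℕ) {N : ℕ} (Y : Set (Fin N → Fin 2)) : Prop where
  exists_support : ∃ n : (Fin N → Fin 2) → ℕ,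
    (fun x => (n x : ℝ)) ∈ interactionSpace k (fun _ : Fin N => Fin 2) ∧ ∀ x, n x = 0 ↔ x ∈ Y
  exists_dual : ∀ y ∈ Y, ∃ g ∈ interactionSpace k (fun _ : Fin N => Fin 2),
    ∀ z ∈ Y, g z = if z = y then 1 else 0

theorem isSimplicialFace_empty (k N : ℕ) : IsSimplicialFace k (∅ : Set (Fin N → Fin 2)) where
  exists_support := by
    refine ⟨fun _ => 1, ?_, by simp⟩
    exact DependsOnlyOn.mem_interactionSpace (s := ∅) (fun _ _ _ => rfl) (by simp)
  exists_dual := by simp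

theorem dependsOnlyOn_ite_forall_eq {N : ℕ} (S : Finset (Fin N)) (a : Fin N → Fin 2) :
    DependsOnlyOn S (fun x : Fin N → Fin 2 => if ∀ i ∈ S, x i = a i then (1 : ℝ) else 0) := by
  intro x y h
  have : (∀ i ∈ S, x i = a i) ↔ ∀ i ∈ S, y i = a i :=
    forall₂_congr fun i hi => by rw [h i hi]
  simp only [this]

/-- The number of coordinates in `S` where `x` differs from `a` is a `1`-interaction. -/
theorem card_filter_ne_mem_interactionSpace {k N : ℕ} (hk : 0 < k) (S : Finset (Fin N))
    (a : Fin N → Fin 2) :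
    (fun x : Fin N → Fin 2 => (((S.filter fun i => x i ≠ a i).card : ℕ) : ℝ)) ∈
      interactionSpace k (fun _ : Fin N => Fin 2) := by
  have h : (fun x : Fin N → Fin 2 => (((S.filter fun i => x i ≠ a i).card : ℕ) : ℝ)) =
      ∑ i ∈ S, fun x : Fin N → Fin 2 => if x i ≠ a i then (1 : ℝ) else 0 := by
    ext x
    simp [Finset.card_filter, Finset.sum_apply]
  rw [h]
  refine Submodule.sum_mem _ fun i _ => ?_
  refine DependsOnlyOn.mem_interactionSpace (s := {i}) (fun x y hxy => ?_) (by simpa)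
  simp only [hxy i (by simp)]

/-- A subcube of dimension at most `k` is a simplicial face. -/
theorem isSimplicialFace_subcube {k N : ℕ} (hk : 0 < k) {T : Finset (Fin N)} (hT : T.card ≤ k)
    (a : Fin N → Fin 2) :
    IsSimplicialFace k {x : Fin N → Fin 2 | ∀ i ∉ T, x i = a i} where
  exists_support := by
    refine ⟨_, card_filter_ne_mem_interactionSpace hk Tᶜ a, fun x => ?_⟩
    simp [Finset.filter_eq_empty_iff]
  exists_dual := by
    intro y hy
    refine ⟨_, (dependsOnlyOn_ite_forall_eq T y).mem_interactionSpace hT, fun z hz => ?_⟩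
    have : (∀ i ∈ T, z i = y i) ↔ z = y := by
      refine ⟨fun h => funext fun i => ?_, fun h i _ => h ▸ rfl⟩
      by_cases hi : i ∈ T
      · exact h i hi
      · rw [hz i hi, hy i hi]
    simp only [this]

/-- A subcube of dimension `k + 1` with an edge removed is a simplicial face. -/
theorem isSimplicialFace_subcube_diff_edge {k N : ℕ} (hk : 0 < k) {S : Finset (Fin N)}
    (hS : S.card = k) {u : Fin N} (hu : u ∉ S) (a : Fin N → Fin 2) :
    IsSimplicialFace k
      {x : Fin N → Fin 2 | (∀ i ∉ insert u S, x i = a i) ∧ ¬ ∀ i ∈ S, x i = 0} where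
  exists_support := by
    refine ⟨fun x => ((insert u S)ᶜ.filter fun i => x i ≠ a i).card +
      if ∀ i ∈ S, x i = 0 then 1 else 0, ?_, fun x => ?_⟩
    · have := Submodule.add_mem _ (card_filter_ne_mem_interactionSpace hk (insert u S)ᶜ a)
        ((dependsOnlyOn_ite_forall_eq S 0).mem_interactionSpace hS.le)
      convert this using 2 with x
      simp
    · rw [Nat.add_eq_zero_iff]
      simp [Finset.filter_eq_empty_iff]
  exists_dual := by
    intro y hy
    replace hy := hy.1
    induction hr : (S.filter fun i => y i ≠ 0).card generalizing y with
    | zero =>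
      refine ⟨0, Submodule.zero_mem _, fun z hz => ?_⟩
      have h0 : ∀ i ∈ S, y i = 0 := by
        simpa [Finset.filter_eq_empty_iff] using hr
      have : z ≠ y := fun h => hz.2 (h ▸ h0)
      simp [this]
    | succ r ih =>
      obtain ⟨j, hj⟩ := Finset.card_pos.mp (r.succ_pos.trans_eq hr.symm)
      obtain ⟨hjS, hyj⟩ := Finset.mem_filter.mp hj
      have hcard : (S.filter fun i => Function.update y j 0 i ≠ 0).card = r := by
        have : (S.filter fun i => Function.update y j 0 i ≠ 0) =
            (S.filter fun i => y i ≠ 0).erase j := by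
          ext i
          by_cases h : i = j
          · simp [h]
          · simp [h]
        rw [this, Finset.card_erase_of_mem hj, hr]
        rfl
      obtain ⟨g, hg, hgz⟩ := ih (Function.update y j 0) (fun i hi => by
        have : i ≠ j := fun h => hi (h ▸ Finset.mem_insert_of_mem hjS)
        rw [Function.update_of_ne this, hy i hi]) hcard
      have hle : ((insert u S).erase j).card ≤ k := by
        rw [Finset.card_erase_of_mem (Finset.mem_insert_of_mem hjS),
          Finset.card_insert_of_notMem hu, hS]
        rfl
      refine ⟨_, Submodule.sub_mem _
        ((dependsOnlyOn_ite_forall_eq ((insert u S).erase j) y).mem_interactionSpace hle) hg,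
        fun z hz => ?_⟩
      have hedge : (∀ i ∈ (insert u S).erase j, z i = y i) ↔
          z = y ∨ z = Function.update y j 0 := by
        constructor
        · intro h
          have h' : ∀ i, i ≠ j → z i = y i := fun i hi => by
            by_cases hiU : i ∈ insert u S
            · exact h i (Finset.mem_erase.mpr ⟨hi, hiU⟩)
            · rw [hz.1 i hiU, hy i hiU]
          by_cases hzj : z j = 0
          · right
            ext1 i
            by_cases hi : i = j
            · subst hi
              simpa using hzj
            · rw [Function.update_of_ne hi, h' i hi]
          · left
            ext1 i
            by_cases hi : i = j
            · subst hi
              omega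
            · exact h' i hi
        · rintro (rfl | rfl) i hi
          · rfl
          · rw [Function.update_of_ne (Finset.ne_of_mem_erase hi)]
      have hne : Function.update y j 0 ≠ y := fun h => hyj (by
        rw [← h]
        simp)
      simp only [Pi.sub_apply, hgz z hz, hedge]
      by_cases h1 : z = y
      · simp [h1, hne.symm]
      · simp [h1]

/-- A subcube of positive dimension `d` splits into at most `⌈2 ^ (d - 1) / (2 ^ k - 1)⌉`
simplicial faces. -/
theorem exists_coloring_isSimplicialFace {k N : ℕ} (hk : 0 < k) (T : Finset (Fin N))
    (hT : T.Nonempty) :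
    ∃ (ι : Type) (_ : Fintype ι) (c : (Fin N → Fin 2) → ι),
      Fintype.card ι * (2 ^ k - 1) < 2 ^ (T.card - 1) + (2 ^ k - 1) ∧
      ∀ i, IsSimplicialFace k {x : Fin N → Fin 2 | (∀ j ∉ T, x j = 0) ∧ c x = i} := by
  induction hd : T.card using Nat.strong_induction_on generalizing T with
  | _ d ih =>
  rcases le_or_gt d k with hdk | hdk
  · refine ⟨Unit, inferInstance, fun _ => (), by simp, fun i => ?_⟩
    simpa using isSimplicialFace_subcube hk (hd ▸ hdk) (0 : Fin N → Fin 2)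
  · obtain ⟨u, huT⟩ := hT
    obtain ⟨S, hST, hS⟩ := Finset.exists_subset_card_eq (s := T.erase u) (n := k) (by
      rw [Finset.card_erase_of_mem huT]
      omega)
    have huS : u ∉ S := fun h => by simpa using hST h
    have hST' : S ⊆ T := hST.trans (Finset.erase_subset _ _)
    have hcard : (T \ S).card = d - k := by
      rw [Finset.card_sdiff_of_subset hST', hd, hS]
    obtain ⟨ι, _, c, hc, hface⟩ := ih (d - k) (by omega) (T \ S)
      ⟨u, Finset.mem_sdiff.mpr ⟨huT, huS⟩⟩ hcard
    classical
    let W := ((T \ S).erase u : Finset (Fin N))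
    have hW : W.card = d - k - 1 := by
      rw [Finset.card_erase_of_mem (Finset.mem_sdiff.mpr ⟨huT, huS⟩), hcard]
    refine ⟨(W → Fin 2) ⊕ ι, inferInstance, fun x =>
      if ∀ i ∈ S, x i = 0 then Sum.inr (c x) else Sum.inl fun i => x i, ?_, ?_⟩
    · have h2 : 2 ^ (d - 1) = 2 ^ (d - k - 1) * (2 ^ k - 1) + 2 ^ (d - k - 1) := by
        rw [← Nat.mul_succ, Nat.succ_eq_add_one, Nat.sub_add_cancel Nat.one_le_two_pow, ← pow_add]
        congr 1
        omega
      simp only [Fintype.card_sum, Fintype.card_fun, Fintype.card_fin, Fintype.card_coe, hW,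
        add_mul]
      omega
    · rintro (w | i)
      · convert isSimplicialFace_subcube_diff_edge hk hS huS
          (fun i => if h : i ∈ W then w ⟨i, h⟩ else 0) using 2
        ext x
        by_cases hx : ∀ i ∈ S, x i = 0
        · simp only [if_pos hx, reduceCtorEq, and_false, false_iff]
          exact fun h => h.2 hx
        · beta_reduce
          rw [if_neg hx, Sum.inl.injEq]
          simp only [hx, not_false_eq_true, and_true]
          constructor
          · rintro ⟨h0, rfl⟩ i hi
            by_cases hiW : i ∈ W
            · simp [hiW]
            · simp only [hiW, dite_false]
              refine h0 i fun hiT => hiW ?_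
              simp only [Finset.mem_insert, not_or] at hi
              simp [W, hi, hiT]
          · intro h
            refine ⟨fun i hi => ?_, funext fun i => ?_⟩
            · have hiW : i ∉ W := fun h => hi (by
                simp only [W, Finset.mem_erase, Finset.mem_sdiff] at h
                exact h.2.1)
              have := h i (by
                simp only [Finset.mem_insert, not_or]
                exact ⟨fun h => hi (h ▸ huT), fun h => hi (hST' h)⟩)
              simpa [hiW] using this
            · obtain ⟨i, hi⟩ := i
              have hi' := hi
              simp only [W, Finset.mem_erase, Finset.mem_sdiff] at hi'
              have := h i (by simp [hi'])
              simpa [hi] using this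
      · convert hface i using 2
        ext x
        by_cases hx : ∀ i ∈ S, x i = 0
        · simp only [if_pos hx, Sum.inr.injEq, Finset.mem_sdiff]
          refine and_congr_left fun _ => ⟨fun h j hj => ?_, fun h j hj => h j fun h' => hj h'.1⟩
          by_cases hjS : j ∈ S
          · exact hx j hjS
          · exact h j fun hjT => hj ⟨hjT, hjS⟩
        · simp only [if_neg hx, reduceCtorEq, and_false, false_iff, not_and]
          intro h
          exact absurd (fun i hi => h i (by simp [hi])) hx

open Topology in
/-- For small `s`, the perturbed identity `q ↦ q + s • R (q, s)` still attains `p` near `p`. -/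
theorem exists_add_smul_eq_of_contDiffAt {E : Type*} [NormedAddCommGroup E] [NormedSpace ℝ E]
    [CompleteSpace E] {R : E × ℝ → E} {p : E} (hR : ContDiffAt ℝ 1 R (p, 0)) {U : Set E}
    (hU : U ∈ 𝓝 p) : ∃ q ∈ U, ∃ s : ℝ, 0 < s ∧ q + s • R (q, s) = p := by
  let Φ : E × ℝ → E × ℝ := fun z => (z.1 + z.2 • R z, z.2)
  have hΦ := ((hasStrictFDerivAt_fst (𝕜 := ℝ) (p := (p, (0 : ℝ)))).add
    (hasStrictFDerivAt_snd.smul (hR.hasStrictFDerivAt one_ne_zero))).prodMk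
      (hasStrictFDerivAt_snd (𝕜 := ℝ) (p := (p, (0 : ℝ))))
  have hmap := hΦ.map_nhds_eq_of_surj (by
    rw [LinearMap.range_eq_top]
    rintro ⟨v, r⟩
    refine ⟨(v - r • R (p, 0), r), ?_⟩
    simp)
  have hmem : Φ '' (U ×ˢ Set.univ) ∈ 𝓝 (p, (0 : ℝ)) := by
    have : Φ '' (U ×ˢ Set.univ) ∈ Filter.map Φ (𝓝 (p, (0 : ℝ))) :=
      Filter.image_mem_map (prod_mem_nhds hU Filter.univ_mem)
    have h2 : Filter.map Φ (𝓝 (p, (0 : ℝ))) = 𝓝 (p, (0 : ℝ)) := by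
      refine hmap.trans ?_
      simp
    rwa [h2] at this
  have hcont : Filter.Tendsto (fun s : ℝ => (p, s)) (𝓝[>] 0) (𝓝 (p, (0 : ℝ))) :=
    (Continuous.tendsto (by fun_prop) 0).mono_left nhdsWithin_le_nhds
  obtain ⟨s, ⟨⟨q, t⟩, ⟨hq, -⟩, hqt⟩, hs⟩ :=
    ((hcont.eventually hmem).and self_mem_nhdsWithin).exists
  simp only [Φ, Prod.mk.injEq] at hqt
  obtain ⟨h1, rfl⟩ := hqt
  exact ⟨q, hq, t, hs, h1⟩

/-- If the cube is partitioned into the simplicial faces `c ⁻¹' {i}`, then every strictly positive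
function is a sum of exponentials of `k`-interactions, one for each face. -/
theorem exists_sum_exp_eq_of_isSimplicialFace {k N : ℕ} {ι : Type*} [Fintype ι]
    (c : (Fin N → Fin 2) → ι) (hc : ∀ i, IsSimplicialFace k {x | c x = i})
    (p : (Fin N → Fin 2) → ℝ) (hpos : ∀ x, 0 < p x) :
    ∃ g : ι → (Fin N → Fin 2) → ℝ, (∀ i, g i ∈ interactionSpace k (fun _ : Fin N => Fin 2)) ∧
      ∀ x, p x = ∑ i, Real.exp (g i x) := by
  classical
  choose n hn hn0 using fun i => (hc i).exists_support
  choose G hG hGz using fun y => (hc (c y)).exists_dual y rfl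
  let φ : ((Fin N → Fin 2) → ℝ) → ι → (Fin N → Fin 2) → ℝ := fun q i x =>
    ∑ y with c y = i, Real.log (q y) * G y x
  let R : ((Fin N → Fin 2) → ℝ) × ℝ → (Fin N → Fin 2) → ℝ := fun z x =>
    ∑ i ∈ Finset.univ.erase (c x), Real.exp (φ z.1 i x) * z.2 ^ (n i x - 1)
  have hR : ContDiffAt ℝ 1 R (p, 0) := by
    refine contDiffAt_pi.mpr fun x => ContDiffAt.sum fun i _ => ContDiffAt.mul ?_ ?_
    · refine ContDiffAt.exp (ContDiffAt.sum fun y _ => ContDiffAt.mul ?_ contDiffAt_const)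
      exact ContDiffAt.log (by fun_prop) (hpos y).ne'
    · exact ContDiffAt.pow contDiffAt_snd _
  obtain ⟨q, hq, s, hs, hqs⟩ := exists_add_smul_eq_of_contDiffAt hR
    (U := {q | ∀ x, 0 < q x})
    (Filter.eventually_all.mpr fun x =>
      (continuous_apply x).continuousAt.eventually (lt_mem_nhds (hpos x)))
  refine ⟨fun i x => φ q i x + Real.log s * n i x, fun i => ?_, fun x => ?_⟩
  · have h1 : φ q i ∈ interactionSpace k (fun _ : Fin N => Fin 2) := by
      have : φ q i = ∑ y with c y = i, Real.log (q y) • G y := by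
        ext x
        simp [φ, Finset.sum_apply]
      rw [this]
      exact Submodule.sum_mem _ fun y _ => Submodule.smul_mem _ _ (hG y)
    exact Submodule.add_mem _ h1 (Submodule.smul_mem _ (Real.log s) (hn i))
  · have hexp : ∀ i, Real.exp (φ q i x + Real.log s * n i x) =
        Real.exp (φ q i x) * s ^ n i x := fun i => by
      rw [Real.exp_add, mul_comm (Real.log s), Real.exp_nat_mul, Real.exp_log hs]
    have hφ : φ q (c x) x = Real.log (q x) := by
      have : ∀ y ∈ Finset.univ.filter (fun y => c y = c x),
          Real.log (q y) * G y x = if y = x then Real.log (q x) else 0 := fun y hy => by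
        rw [hGz y x (Finset.mem_filter.mp hy).2.symm]
        rcases eq_or_ne y x with rfl | h
        · simp
        · simp [h, h.symm]
      simp only [φ]
      rw [Finset.sum_congr rfl this]
      simp
    simp only [hexp]
    rw [← Finset.add_sum_erase _ _ (Finset.mem_univ (c x)), hφ, Real.exp_log (hq x),
      (hn0 (c x) x).mpr rfl, pow_zero, mul_one, ← congrFun hqs x]
    simp only [Pi.add_apply, Pi.smul_apply, smul_eq_mul, R, Finset.mul_sum]
    congr 1
    refine Finset.sum_congr rfl fun i hi => ?_
    have hne : n i x ≠ 0 := fun h => Finset.ne_of_mem_erase hi ((hn0 i x).mp h).symm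
    obtain ⟨r, hr⟩ := Nat.exists_eq_succ_of_ne_zero hne
    rw [hr, Nat.succ_eq_add_one, Nat.add_sub_cancel, pow_succ]
    ring


/-- for `0 < k < N` and `m ≥ ⌈2^(N-1)/(2^k - 1)⌉`, every strictly
positive distribution on `{0,1}^N` is a convex combination of `m` elements of
the `k`-interaction exponential family. -/
theorem stmt_5 (N k m : ℕ) (hk : 0 < k) (hkN : k < N)
    (hm : (2 ^ (N - 1) + (2 ^ k - 1) - 1) / (2 ^ k - 1) ≤ m)
    (p : (Fin N → Fin 2) → ℝ) (hp : IsDist p) (hpos : ∀ x, 0 < p x) :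
    ∃ (α : Fin m → ℝ) (f : Fin m → (Fin N → Fin 2) → ℝ),
      (∀ i, 0 ≤ α i) ∧ ∑ i, α i = 1 ∧
      (∀ i, f i ∈ interactionFamily k) ∧
      ∀ x, p x = ∑ i, α i * f i x := by
  obtain ⟨ι, _, c, hcard, hc⟩ := exists_coloring_isSimplicialFace hk
    (Finset.univ : Finset (Fin N)) ⟨⟨0, by omega⟩, Finset.mem_univ _⟩
  simp only [Finset.mem_univ, not_true_eq_false, false_implies, implies_true, true_and,
    Finset.card_univ, Fintype.card_fin] at hcard hc
  have h2k : 0 < 2 ^ k - 1 := Nat.sub_pos_of_lt (Nat.one_lt_two_pow hk.ne')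
  have hle : Fintype.card ι ≤ m := by
    refine le_trans ((Nat.le_div_iff_mul_le h2k).mpr ?_) hm
    omega
  obtain ⟨e⟩ : Nonempty (ι ↪ Fin m) :=
    Function.Embedding.nonempty_of_card_le (by simpa using hle)
  obtain ⟨g, hg, hgp⟩ := exists_sum_exp_eq_of_isSimplicialFace (k := k) (fun x => e (c x))
    (fun i => by
      by_cases hi : ∃ j, e j = i
      · obtain ⟨j, rfl⟩ := hi
        simpa using hc j
      · convert isSimplicialFace_empty k N
        ext x
        simpa using fun h => hi ⟨_, h⟩) p hpos
  have hsum : ∀ i, 0 < ∑ y, Real.exp (g i y) := fun i =>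
    Finset.sum_pos (fun _ _ => Real.exp_pos _) Finset.univ_nonempty
  refine ⟨fun i => ∑ y, Real.exp (g i y), fun i x => Real.exp (g i x) / ∑ y, Real.exp (g i y),
    fun i => (hsum i).le, ?_, fun i => exp_div_mem_interactionFamily (hg i), fun x => ?_⟩
  · rw [Finset.sum_comm, ← hp.2]
    exact Finset.sum_congr rfl fun x _ => (hgp x).symm
  · rw [hgp x]
    exact Finset.sum_congr rfl fun i _ => (mul_div_cancel₀ _ (hsum i).ne').symm
end

section
/- Let X = X_1 × ⋯ × X_N with each X_i finite, let 1 ≤ k ≤ N, let Λ ⊆ {1,…,N} with |Λ| ≤ k, and let y ∈ X. Then every probability distribution p on X with supp(p) ⊆ {x ∈ X : x_j = y_j for all j ∉ Λ} lies in the closure of the k-interaction exponential family E^k; in other words, every cylinder set of dimension at most k is an S-set for E^k. -/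
open Filter Topology

/-- A normalized product of a positive function of the coordinates in `Λ` and positive functions
of single coordinates belongs to the `k`-interaction family, for `1 ≤ k` and `#Λ ≤ k`. -/
theorem normalize_mul_prod_mem_interactionFamily {N k : ℕ} {X : Fin N → Type*}
    [∀ i, Fintype (X i)] (hk : 1 ≤ k) {Λ T : Finset (Fin N)} (hΛ : Λ.card ≤ k)
    {g : ((i : Fin N) → X i) → ℝ} (hg : DependsOnlyOn Λ g) (hg0 : ∀ x, 0 < g x)
    {h : (i : Fin N) → X i → ℝ} (hh0 : ∀ i a, 0 < h i a) :
    (fun x => (g x * ∏ j ∈ T, h j (x j)) / ∑ z, g z * ∏ j ∈ T, h j (z j)) ∈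
      interactionFamily (X := X) k := by
  classical
  let F : Finset (Fin N) → ((i : Fin N) → X i) → ℝ := fun s x =>
    (if s = Λ then Real.log (g x) else 0) +
      ∑ j ∈ T, if s = {j} then Real.log (h j (x j)) else 0
  have hF (x : (i : Fin N) → X i) : Real.exp (∑ s, F s x) = g x * ∏ j ∈ T, h j (x j) := by
    simp only [F, Finset.sum_add_distrib]
    rw [Finset.sum_comm]
    simp [Real.exp_add, Real.exp_sum, Real.exp_log (hg0 x), Real.exp_log (hh0 _ _)]
  refine ⟨F, fun s x z hxz => ?_, fun s hs => ?_, fun x => by simp only [hF]⟩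
  · refine congrArg₂ (· + ·) ?_ (Finset.sum_congr rfl fun j _ => ?_)
    · split_ifs with hs
      · subst hs
        rw [hg x z hxz]
      · rfl
    · split_ifs with hs
      · rw [hxz j (by simp [hs])]
      · rfl
  · funext x
    have hsΛ : s ≠ Λ := by rintro rfl; omega
    have hsj (j : Fin N) : s ≠ {j} := by
      rintro rfl
      rw [Finset.card_singleton] at hs
      omega
    simp [F, hsΛ, hsj]

/-- every cylinder set of dimension at most `k` is an S-set for
the `k`-interaction exponential family: any distribution supported in it lies
in the closure of the family. -/
theorem stmt_7 (N k : ℕ) (X : Fin N → Type*) [∀ i, Fintype (X i)]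
    (hk1 : 1 ≤ k) (hkN : k ≤ N) (Λ : Finset (Fin N)) (hΛ : Λ.card ≤ k)
    (y : (i : Fin N) → X i)
    (p : ((i : Fin N) → X i) → ℝ) (hp : IsDist p)
    (hsupp : {x | 0 < p x} ⊆ {x | ∀ j ∉ Λ, x j = y j}) :
    p ∈ closure (interactionFamily k) := by
  classical
  let g : ℝ → ((i : Fin N) → X i) → ℝ := fun e x => p (fun i => if i ∈ Λ then x i else y i) + e
  let h : ℝ → (i : Fin N) → X i → ℝ := fun e i a => if a = y i then 1 else e
  let w : ℝ → ((i : Fin N) → X i) → ℝ := fun e x => g e x * ∏ j ∈ Λᶜ, h e j (x j)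
  have hw0 (x : (i : Fin N) → X i) : w 0 x = p x := by
    by_cases hx : ∀ j ∉ Λ, x j = y j
    · have hglue : (fun i => if i ∈ Λ then x i else y i) = x := by
        funext i
        split_ifs with hi
        · rfl
        · exact (hx i hi).symm
      have hprod : ∏ j ∈ Λᶜ, h 0 j (x j) = 1 :=
        Finset.prod_eq_one fun j hj => if_pos (hx j (Finset.mem_compl.1 hj))
      simp only [w, g, hglue, hprod, add_zero, mul_one]
    · have hpx : p x = 0 := le_antisymm (not_lt.1 fun hpos => hx (hsupp hpos)) (hp.1 x)
      push Not at hx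
      obtain ⟨j, hj, hxj⟩ := hx
      have hprod : ∏ j ∈ Λᶜ, h 0 j (x j) = 0 :=
        Finset.prod_eq_zero (Finset.mem_compl.2 hj) (if_neg hxj)
      simp only [w, hprod, mul_zero, hpx]
  have hcont (x : (i : Fin N) → X i) : Continuous fun e => w e x := by
    refine (continuous_const.add continuous_id).mul (continuous_finsetProd _ fun j _ => ?_)
    by_cases hj : x j = y j
    · simpa only [h, if_pos hj] using continuous_const
    · simpa only [h, if_neg hj] using continuous_id'
  have hsum : ∑ z, w 0 z = 1 := by simpa only [hw0] using hp.2
  have hlim : Tendsto (fun e x => w e x / ∑ z, w e z) (𝓝[>] 0) (𝓝 p) := by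
    refine tendsto_pi_nhds.2 fun x => ?_
    have hdiv : ContinuousAt (fun e => w e x / ∑ z, w e z) 0 :=
      (hcont x).continuousAt.div (continuous_finsetSum _ fun z _ => hcont z).continuousAt
        (by simp [hsum])
    simpa only [hw0, hp.2, div_one] using hdiv.tendsto.mono_left nhdsWithin_le_nhds
  refine mem_closure_of_tendsto hlim ?_
  filter_upwards [self_mem_nhdsWithin] with e he
  have he : 0 < e := he
  refine normalize_mul_prod_mem_interactionFamily hk1 hΛ (fun x z hxz => ?_)
    (fun x => add_pos_of_nonneg_of_pos (hp.1 _) he) (fun i a => ?_)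
  · have hglue : (fun i => if i ∈ Λ then x i else y i) = fun i => if i ∈ Λ then z i else y i := by
      funext i
      split_ifs with hi
      · exact hxz i hi
      · rfl
    simp only [hglue]
  · simp only [h]
    split_ifs
    · exact one_pos
    · exact he
end

section
/- Let X be a finite set and let E_A be the exponential family on X given by a map A : X → ℝ^d for which there exists c ∈ ℝ^d with ⟨c, A(x)⟩ = 1 for all x ∈ X. Suppose there are sets Y_1, …, Y_m ⊆ X with Y_1 ∪ ⋯ ∪ Y_m = X such that each Y_i is an S-set for E_A, i.e., every probability distribution with support contained in Y_i lies in the closure of E_A. Then every strictly positive probability distribution on X is a convex combination of m elements of E_A itself (not merely of its closure). -/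
/-- The exponential family on `X` with sufficient statistics `A : X → ℝ^d`. -/
def expFam {X : Type*} [Fintype X] {d : ℕ} (A : X → Fin d → ℝ) :
    Set (X → ℝ) :=
  {p | ∃ θ : Fin d → ℝ, ∀ x, p x =
    Real.exp (∑ j, θ j * A x j) / ∑ y, Real.exp (∑ j, θ j * A y j)}

open Filter Topology

section SSets

variable {X : Type*} [Fintype X]

/-- The strictly positive functions whose pointwise logarithm lies in `W`. -/
def expImage (W : Submodule ℝ (X → ℝ)) : Set (X → ℝ) :=
  (fun w x => Real.exp (w x)) '' (W : Set (X → ℝ))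

/-- Over an S-set, every function is the restriction of an element of `W`, and this element
can be chosen linearly. -/
lemma exists_linear_extension {W : Submodule ℝ (X → ℝ)} (hW : (fun _ => 1) ∈ W) {Z : Set X}
    (hZ : ∀ q : X → ℝ, IsDist q → {x | 0 < q x} ⊆ Z → q ∈ closure (expImage W)) :
    ∃ B : (X → ℝ) →ₗ[ℝ] (X → ℝ), (∀ v, B v ∈ W) ∧ ∀ v, ∀ x ∈ Z, B v x = v x := by
  classical
  let R : (X → ℝ) →ₗ[ℝ] (Z → ℝ) := LinearMap.funLeft ℝ ℝ Subtype.val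
  have hsurj : Function.Surjective (R.domRestrict W) := by
    intro v
    suffices h : v ∈ W.map R by
      obtain ⟨w, hw, rfl⟩ := h
      exact ⟨⟨w, hw⟩, rfl⟩
    rcases isEmpty_or_nonempty Z with hE | hE
    · rw [Subsingleton.elim v 0]
      exact zero_mem _
    set S : ℝ := ∑ z, Real.exp (v z)
    have hSpos : 0 < S := Finset.sum_pos (fun z _ => Real.exp_pos _) Finset.univ_nonempty
    let q : X → ℝ := fun x => if h : x ∈ Z then Real.exp (v ⟨x, h⟩) / S else 0
    have hqZ : ∀ z : Z, q z = Real.exp (v z) / S := fun z => by simp [q]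
    have hq : q ∈ closure (expImage W) := by
      refine hZ q ⟨fun x => ?_, ?_⟩ fun x hx => ?_
      · by_cases h : x ∈ Z
        · simp only [q, h, dite_true]; positivity
        · simp [q, h]
      · have h1 : ∑ z : Z, Real.exp (v z) / S = ∑ x, q x :=
          Fintype.sum_of_injective _ Subtype.val_injective _ q
            (fun x hx => by simp_all [q]) fun z => (hqZ z).symm
        rw [← h1, ← Finset.sum_div, div_self hSpos.ne']
      · by_contra h
        simp [q, h] at hx
    let ℓ : (X → ℝ) → Z → ℝ := fun r z => Real.log (r z)
    have hℓ : ContinuousAt ℓ q := by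
      refine continuousAt_pi.2 fun z => ContinuousAt.log (continuousAt_apply _ _) ?_
      rw [hqZ]; positivity
    have hmem : ℓ q ∈ closure (W.map R : Set (Z → ℝ)) := by
      refine closure_mono ?_ (mem_closure_image hℓ hq)
      rintro _ ⟨_, ⟨w, hw, rfl⟩, rfl⟩
      refine ⟨w, hw, ?_⟩
      ext z
      simp [ℓ, R, LinearMap.funLeft]
    rw [(Submodule.closed_of_finiteDimensional (W.map R)).closure_eq] at hmem
    have hone : R (fun _ => 1) ∈ W.map R := ⟨_, hW, rfl⟩
    have hv : v = ℓ q + Real.log S • R (fun _ => 1) := by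
      ext z
      simp only [ℓ, Pi.add_apply, Pi.smul_apply, hqZ, R, LinearMap.funLeft_apply, smul_eq_mul]
      rw [Real.log_div (Real.exp_ne_zero _) hSpos.ne', Real.log_exp]
      ring
    rw [hv]
    exact add_mem hmem (Submodule.smul_mem _ _ hone)
  obtain ⟨g, hg⟩ := LinearMap.exists_rightInverse_of_surjective _ (LinearMap.range_eq_top.2 hsurj)
  refine ⟨W.subtype ∘ₗ g ∘ₗ R, fun v => (g (R v)).2, fun v x hx => ?_⟩
  exact congr_fun (LinearMap.congr_fun hg (R v)) ⟨x, hx⟩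

/-- Elements of `W` vanishing on an S-set can be arbitrarily negative off it. -/
lemma exists_exp_lt {W : Submodule ℝ (X → ℝ)} (hW : (fun _ => 1) ∈ W) {Z : Set X}
    (hZ : ∀ q : X → ℝ, IsDist q → {x | 0 < q x} ⊆ Z → q ∈ closure (expImage W))
    {ε : ℝ} (hε : 0 < ε) :
    ∃ w ∈ W, (∀ x ∈ Z, w x = 0) ∧ ∀ x ∉ Z, Real.exp (w x) < ε := by
  classical
  obtain ⟨B, hBW, hB⟩ := exists_linear_extension hW hZ
  rcases Z.eq_empty_or_nonempty with rfl | ⟨z, hz⟩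
  · refine ⟨(Real.log ε - 1) • fun _ => 1, Submodule.smul_mem _ _ hW, by simp, fun x _ => ?_⟩
    simp only [Pi.smul_apply, smul_eq_mul, mul_one]
    rw [← Real.lt_log_iff_exp_lt hε]
    linarith
  set N : ℝ := ∑ x, if x ∈ Z then 1 else 0
  have hNpos : 0 < N :=
    Finset.sum_pos' (fun x _ => by split_ifs <;> simp) ⟨z, Finset.mem_univ _, by simp [hz]⟩
  let q : X → ℝ := fun x => (if x ∈ Z then 1 else 0) / N
  have hq : q ∈ closure (expImage W) := by
    refine hZ q ⟨fun x => ?_, ?_⟩ fun x hx => ?_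
    · simp only [q]; split_ifs <;> positivity
    · simp only [q]
      rw [← Finset.sum_div, div_self hNpos.ne']
    · by_contra h
      simp [q, h] at hx
  let φ : (X → ℝ) → X → ℝ := fun r x => if x ∈ Z then Real.log (r x) else 0
  have hφ : ContinuousAt φ q := by
    refine continuousAt_pi.2 fun x => ?_
    by_cases h : x ∈ Z
    · simp only [φ, h, if_true]
      refine ContinuousAt.log (continuousAt_apply _ _) ?_
      simp only [q, h, if_true]; positivity
    · simp only [φ, h, if_false]
      exact continuousAt_const
  have hBc : Continuous B := B.continuous_of_finiteDimensional
  have hev : ∀ᶠ r in 𝓝 q, ∀ x, x ∉ Z → r x * Real.exp (-(B (φ r) x)) < ε := by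
    refine eventually_all.2 fun x => ?_
    by_cases h : x ∈ Z
    · simp [h]
    have hc : ContinuousAt (fun r : X → ℝ => r x * Real.exp (-(B (φ r) x))) q := by
      have h1 : ContinuousAt (fun r => B (φ r)) q := hBc.continuousAt.comp hφ
      have h2 : ContinuousAt (fun r => B (φ r) x) q := continuousAt_pi.1 h1 x
      exact (continuousAt_apply x q).mul h2.neg.rexp
    have h0 : q x * Real.exp (-(B (φ q) x)) < ε := by simpa [q, h] using hε
    filter_upwards [hc.eventually_lt continuousAt_const h0] with r hr _ using hr
  obtain ⟨r, hr, w, hw, rfl⟩ := mem_closure_iff_nhds.1 hq _ hev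
  refine ⟨w - B (φ fun x => Real.exp (w x)), sub_mem hw (hBW _), fun x hx => ?_, fun x hx => ?_⟩
  · simp [hB _ x hx, φ, hx]
  · have := hr x hx
    rwa [← Real.exp_add, ← sub_eq_add_neg] at this

end SSets

/-- If `H (·, 0)` is the identity, then `H (·, c)` attains the value `a` near `a` for all
small `c`. -/
lemma eventually_exists_eq_of_contDiffAt {E C : Type*}
    [NormedAddCommGroup E] [NormedSpace ℝ E] [CompleteSpace E]
    [NormedAddCommGroup C] [NormedSpace ℝ C] [CompleteSpace C]
    {H : E × C → E} {a : E} (hH : ContDiffAt ℝ 1 H (a, 0)) (h0 : ∀ g, H (g, 0) = g)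
    {s : Set E} (hs : s ∈ 𝓝 a) :
    ∀ᶠ c in 𝓝 (0 : C), ∃ g ∈ s, H (g, c) = a := by
  have hd := hH.hasStrictFDerivAt one_ne_zero
  set H' := fderiv ℝ H (a, 0)
  have hH' : ∀ u, H' (u, 0) = u := by
    have h1 : HasFDerivAt (fun g : E => H (g, 0)) (H'.comp (.inl ℝ E C)) a :=
      HasFDerivAt.comp a (g := H) hd.hasFDerivAt (hasFDerivAt_prodMk_left a (0 : C))
    have h2 : HasFDerivAt (fun g : E => H (g, 0)) (.id ℝ E) a := by
      simp only [h0]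
      exact hasFDerivAt_id a
    intro u
    simpa using DFunLike.congr_fun (h1.unique h2) u
  have hΨ : HasStrictFDerivAt (fun y : E × C => (H y, y.2))
      (H'.prod (.snd ℝ E C)) (a, 0) := hd.prodMk hasStrictFDerivAt_snd
  have hsurj : (H'.prod (.snd ℝ E C)).range = ⊤ := by
    refine LinearMap.range_eq_top.2 fun ⟨u, v⟩ => ⟨(u - H' (0, v), v), ?_⟩
    have : ((u - H' (0, v), v) : E × C) = (u - H' (0, v), 0) + (0, v) := by simp
    have h3 : H' (u - H' (0, v), v) = u := by rw [this, map_add, hH']; abel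
    simp [h3]
  have hmap := hΨ.map_nhds_eq_of_surj hsurj
  have hn : (fun y : E × C => (H y, y.2)) '' (s ×ˢ Set.univ) ∈ 𝓝 (a, (0 : C)) := by
    have := image_mem_map (m := fun y : E × C => (H y, y.2))
      (prod_mem_nhds hs (univ_mem : Set.univ ∈ 𝓝 (0 : C)))
    rwa [hmap, h0] at this
  have ht : Tendsto (fun c : C => (a, c)) (𝓝 0) (𝓝 (a, 0)) := by
    exact (Continuous.prodMk_right a).tendsto 0
  filter_upwards [ht hn] with c hc
  obtain ⟨⟨g, c'⟩, hg, he⟩ := hc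
  obtain ⟨h4, rfl⟩ := Prod.mk.inj he
  exact ⟨g, hg.1, h4⟩

/-- if `X` is covered by `m` S-sets of `E_A`, then every strictly
positive distribution on `X` is a convex combination of `m` elements of `E_A`
itself. -/
theorem stmt_8 {X : Type*} [Fintype X] {d m : ℕ} (A : X → Fin d → ℝ)
    (hc : ∃ c : Fin d → ℝ, ∀ x, ∑ j, c j * A x j = 1)
    (Y : Fin m → Set X) (hcov : (⋃ i, Y i) = Set.univ)
    (hS : ∀ i, ∀ p : X → ℝ, IsDist p → {x | 0 < p x} ⊆ Y i →
      p ∈ closure (expFam A))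
    (p : X → ℝ) (hp : IsDist p) (hpos : ∀ x, 0 < p x) :
    ∃ (α : Fin m → ℝ) (f : Fin m → X → ℝ),
      (∀ i, 0 ≤ α i) ∧ ∑ i, α i = 1 ∧ (∀ i, f i ∈ expFam A) ∧
      ∀ x, p x = ∑ i, α i * f i x := by
  classical
  obtain ⟨c, hc⟩ := hc
  let M : (Fin d → ℝ) →ₗ[ℝ] (X → ℝ) :=
    { toFun := fun θ x => ∑ j, θ j * A x j
      map_add' := fun θ η => by ext x; simp [add_mul, Finset.sum_add_distrib]
      map_smul' := fun a θ => by ext x; simp [Finset.mul_sum, mul_assoc] }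
  have hW : (fun _ => 1) ∈ M.range := ⟨c, funext hc⟩
  have : Nonempty X := by
    by_contra h
    rw [not_nonempty_iff] at h
    simpa using hp.2
  have hsub : expFam A ⊆ expImage M.range := by
    rintro q ⟨θ, hθ⟩
    have hpos : 0 < ∑ y, Real.exp (M θ y) :=
      Finset.sum_pos (fun _ _ => Real.exp_pos _) Finset.univ_nonempty
    refine ⟨M θ - Real.log (∑ y, Real.exp (M θ y)) • (fun _ => 1),
      sub_mem ⟨θ, rfl⟩ (Submodule.smul_mem _ _ hW), ?_⟩
    ext x
    simp only [Pi.sub_apply, Pi.smul_apply, smul_eq_mul, mul_one]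
    rw [Real.exp_sub, Real.exp_log hpos, hθ]
    rfl
  have hk : ∀ x, ∃ i, x ∈ Y i := fun x => Set.mem_iUnion.1 (hcov ▸ Set.mem_univ x)
  choose k hk using hk
  have hZ : ∀ i, ∀ q : X → ℝ, IsDist q → {x | 0 < q x} ⊆ {x | k x = i} →
      q ∈ closure (expImage M.range) := fun i q hq hqs =>
    closure_mono hsub (hS i q hq (hqs.trans fun x (hx : k x = i) => hx ▸ hk x))
  choose B hBW hB using fun i => exists_linear_extension hW (hZ i)
  let H : (X → ℝ) × (Fin m → X → ℝ) → X → ℝ := fun y x =>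
    y.1 x + ∑ i, y.2 i x * Real.exp (B i (fun z => Real.log (y.1 z)) x)
  have hH : ContDiffAt ℝ 1 H (p, 0) := by
    have hlog : ContDiffAt ℝ 1
        (fun (y : (X → ℝ) × (Fin m → X → ℝ)) z => Real.log (y.1 z)) (p, 0) :=
      contDiffAt_pi.2 fun z => ContDiffAt.log (by fun_prop) (hpos z).ne'
    refine contDiffAt_pi.2 fun x => ContDiffAt.add (by fun_prop) ?_
    refine ContDiffAt.sum fun i _ => ContDiffAt.mul (by fun_prop) (ContDiffAt.exp ?_)
    have h1 : ContDiffAt ℝ 1 (fun y : (X → ℝ) × (Fin m → X → ℝ) =>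
        (B i).toContinuousLinearMap (fun z => Real.log (y.1 z))) (p, 0) :=
      (ContinuousLinearMap.contDiff _).contDiffAt.comp _ hlog
    exact contDiffAt_pi.1 h1 x
  have hs : {g : X → ℝ | ∀ x, 0 < g x} ∈ 𝓝 p :=
    eventually_all.2 fun x =>
      continuousAt_const.eventually_lt (continuousAt_apply x p) (hpos x)
  have hev := eventually_exists_eq_of_contDiffAt hH (fun g => by ext x; simp [H]) hs
  obtain ⟨ε, hε, hball⟩ := Metric.eventually_nhds_iff.1 hev
  choose w hwW hw0 hwε using fun i => exists_exp_lt hW (hZ i) hε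
  obtain ⟨g, hg, hgp⟩ := hball
    (y := fun i x => if k x = i then 0 else Real.exp (w i x)) (by
      refine (dist_pi_lt_iff hε).2 fun i => (dist_pi_lt_iff hε).2 fun x => ?_
      by_cases h : k x = i
      · simpa [h] using hε
      · simpa [h] using hwε i x h)
  let v : Fin m → X → ℝ := fun i => w i + B i fun z => Real.log (g z)
  have hv : ∀ i, v i ∈ M.range := fun i => add_mem (hwW i) (hBW i _)
  have hpv : ∀ x, p x = ∑ i, Real.exp (v i x) := by
    intro x
    have hx : Real.exp (v (k x) x) = g x := by
      simp only [v, Pi.add_apply]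
      rw [hw0 (k x) x rfl, hB (k x) _ x rfl, zero_add, Real.exp_log (hg x)]
    rw [← hgp, ← Finset.add_sum_erase _ _ (Finset.mem_univ (k x)), hx]
    simp only [H]
    rw [← Finset.add_sum_erase (a := k x) _ _ (Finset.mem_univ _)]
    simp only [if_true, zero_mul, zero_add]
    congr 1
    refine Finset.sum_congr rfl fun i hi => ?_
    rw [if_neg (Finset.ne_of_mem_erase hi).symm, ← Real.exp_add]
    rfl
  have hvpos : ∀ i, 0 < ∑ y, Real.exp (v i y) := fun i =>
    Finset.sum_pos (fun _ _ => Real.exp_pos _) Finset.univ_nonempty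
  refine ⟨fun i => ∑ y, Real.exp (v i y),
    fun i x => Real.exp (v i x) / ∑ y, Real.exp (v i y), fun i => (hvpos i).le, ?_, fun i => ?_,
    fun x => ?_⟩
  · rw [Finset.sum_comm, ← hp.2]
    exact Finset.sum_congr rfl fun x _ => (hpv x).symm
  · obtain ⟨θ, hθ⟩ := hv i
    refine ⟨θ, fun x => ?_⟩
    simp only [← hθ]
    rfl
  · rw [hpv]
    exact Finset.sum_congr rfl fun i _ => (mul_div_cancel₀ _ (hvpos i).ne').symm
end

section
/- Let X be a finite set and let A : X → ℝ^d be a map such that there exists c ∈ ℝ^d with ⟨c, A(x)⟩ = 1 for all x ∈ X, with associated exponential family E_A. For any Y ⊆ X the following are equivalent: (a) every probability distribution p with supp(p) = Y lies in the closure of E_A; (b) every probability distribution p with supp(p) ⊆ Y lies in the closure of E_A; (c) for every nonzero function m : X → ℝ with ∑_{x∈X} m(x)·A(x) = 0, the set {x ∈ X : m(x) > 0} is not contained in Y. -/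
section

open Filter Topology

variable {X : Type*} [Fintype X] {d : ℕ}

theorem sum_exp_pos [Nonempty X] (f : X → ℝ) : 0 < ∑ x, Real.exp (f x) :=
  Finset.sum_pos (fun x _ => Real.exp_pos (f x)) Finset.univ_nonempty

theorem IsDist.nonempty {p : X → ℝ} (hp : IsDist p) : Nonempty X := by
  by_contra h
  rw [not_nonempty_iff] at h
  simpa using hp.2

theorem expFam_pos [Nonempty X] {A : X → Fin d → ℝ} {q : X → ℝ} (hq : q ∈ expFam A) (x : X) :
    0 < q x := by
  obtain ⟨θ, hθ⟩ := hq
  rw [hθ]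
  exact div_pos (Real.exp_pos _) (sum_exp_pos _)

theorem expFam_subset_stdSimplex [Nonempty X] (A : X → Fin d → ℝ) :
    expFam A ⊆ stdSimplex ℝ X := by
  intro q hq
  refine ⟨fun x => (expFam_pos hq x).le, ?_⟩
  obtain ⟨θ, hθ⟩ := hq
  simp_rw [hθ, ← Finset.sum_div]
  exact div_self (sum_exp_pos _).ne'

/-- The log-partition function dominates the mean of the exponent. -/
theorem sum_mul_le_log_sum_exp {p : X → ℝ} (hp : IsDist p) (f : X → ℝ) :
    ∑ x, p x * f x ≤ Real.log (∑ x, Real.exp (f x)) := by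
  have := hp.nonempty
  calc ∑ x, p x * f x ≤ ∑ x, p x * Real.log (∑ y, Real.exp (f y)) := by
        refine Finset.sum_le_sum fun x _ => mul_le_mul_of_nonneg_left ?_ (hp.1 x)
        rw [Real.le_log_iff_exp_le (sum_exp_pos f)]
        exact Finset.single_le_sum (f := fun y => Real.exp (f y))
          (fun y _ => (Real.exp_pos _).le) (Finset.mem_univ x)
    _ = _ := by rw [← Finset.sum_mul, hp.2, one_mul]

/-- The negative log-likelihood of `p`, with a quadratic penalty of weight `ε`. -/
noncomputable def penalizedLoss (A : X → Fin d → ℝ) (p : X → ℝ) (ε : ℝ) (θ : Fin d → ℝ) : ℝ :=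
  Real.log (∑ x, Real.exp (∑ j, θ j * A x j)) - ∑ x, p x * ∑ j, θ j * A x j + ε * ∑ j, θ j ^ 2

theorem mul_sq_le_penalizedLoss (A : X → Fin d → ℝ) {p : X → ℝ} (hp : IsDist p) {ε : ℝ}
    (hε : 0 < ε) (θ : Fin d → ℝ) (k : Fin d) : ε * θ k ^ 2 ≤ penalizedLoss A p ε θ := by
  have h1 := sum_mul_le_log_sum_exp hp fun x => ∑ j, θ j * A x j
  have h2 : ε * θ k ^ 2 ≤ ε * ∑ j, θ j ^ 2 :=
    mul_le_mul_of_nonneg_left (Finset.single_le_sum (f := fun j => θ j ^ 2)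
      (fun j _ => sq_nonneg _) (Finset.mem_univ k)) hε.le
  unfold penalizedLoss
  linarith

theorem penalizedLoss_zero (A : X → Fin d → ℝ) (p : X → ℝ) (ε : ℝ) :
    penalizedLoss A p ε 0 = Real.log (Fintype.card X) := by
  simp [penalizedLoss]

theorem exists_forall_penalizedLoss_le (A : X → Fin d → ℝ) {p : X → ℝ} (hp : IsDist p) {ε : ℝ}
    (hε : 0 < ε) : ∃ θ, ∀ η, penalizedLoss A p ε θ ≤ penalizedLoss A p ε η := by
  have := hp.nonempty
  have hcont : Continuous (penalizedLoss A p ε) := by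
    unfold penalizedLoss
    refine Continuous.add (Continuous.sub (Continuous.log (by fun_prop) fun θ => ?_)
      (by fun_prop)) (by fun_prop)
    exact (sum_exp_pos _).ne'
  set C := penalizedLoss A p ε 0 with hC
  have hbdd : Bornology.IsBounded {θ | penalizedLoss A p ε θ ≤ C} := by
    refine (Metric.isBounded_closedBall (x := (0 : Fin d → ℝ))
      (r := √(C / ε))).subset fun θ hθ => ?_
    rw [mem_closedBall_zero_iff, pi_norm_le_iff_of_nonneg (Real.sqrt_nonneg _)]
    intro k
    refine Real.abs_le_sqrt ?_
    rw [le_div_iff₀ hε, mul_comm]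
    exact (mul_sq_le_penalizedLoss A hp hε θ k).trans hθ
  refine hcont.exists_forall_le' 0 ?_
  have h := Metric.isCompact_of_isClosed_isBounded
    (isClosed_le hcont continuous_const) hbdd |>.compl_mem_cocompact
  filter_upwards [h] with θ hθ
  exact (le_total _ _).resolve_left hθ

/-- Moment equation at a minimizer of the penalized loss. -/
theorem penalizedLoss_stationary [Nonempty X] (A : X → Fin d → ℝ) (p : X → ℝ) (ε : ℝ)
    {θ : Fin d → ℝ} (hθ : ∀ η, penalizedLoss A p ε θ ≤ penalizedLoss A p ε η) (k : Fin d) :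
    ∑ x, (Real.exp (∑ j, θ j * A x j) / ∑ y, Real.exp (∑ j, θ j * A y j) - p x) * A x k
      = -(2 * ε * θ k) := by
  have hlin (x : X) (t : ℝ) : ∑ j, (θ j + t * (Pi.single k 1 : Fin d → ℝ) j) * A x j
      = ∑ j, θ j * A x j + t * A x k := by
    simp [add_mul, Finset.sum_add_distrib, Pi.single_apply]
  have hsq (t : ℝ) : ∑ j, (θ j + t * (Pi.single k 1 : Fin d → ℝ) j) ^ 2
      = ∑ j, θ j ^ 2 + 2 * t * θ k + t ^ 2 := by
    simp [add_sq, Finset.sum_add_distrib, Pi.single_apply]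
    ring
  let g : ℝ → ℝ := fun t => Real.log (∑ x, Real.exp (∑ j, θ j * A x j + t * A x k))
    - ∑ x, p x * (∑ j, θ j * A x j + t * A x k) + ε * (∑ j, θ j ^ 2 + 2 * t * θ k + t ^ 2)
  have hg (t : ℝ) : g t = penalizedLoss A p ε fun j => θ j + t * (Pi.single k 1 : Fin d → ℝ) j := by
    simp only [g, penalizedLoss, hlin, hsq]
  have hmin : IsLocalMin g 0 := by
    refine Eventually.of_forall fun t => ?_
    rw [hg, hg]
    simpa using hθ _
  have haff (x : X) : HasDerivAt (fun t : ℝ => ∑ j, θ j * A x j + t * A x k) (A x k) 0 := by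
    simpa using ((hasDerivAt_id (0 : ℝ)).mul_const (A x k)).const_add (∑ j, θ j * A x j)
  have hexp := (HasDerivAt.fun_sum (u := Finset.univ) fun x _ => (haff x).exp).log
    (sum_exp_pos _).ne'
  have hmean := HasDerivAt.fun_sum (u := Finset.univ) fun x _ => (haff x).const_mul (p x)
  have hpen : HasDerivAt (fun t : ℝ => ε * (∑ j, θ j ^ 2 + 2 * t * θ k + t ^ 2))
      (ε * (2 * θ k)) 0 := by
    have h := (((((hasDerivAt_id (0 : ℝ)).const_mul 2).mul_const (θ k)).const_add
      (∑ j, θ j ^ 2)).add (hasDerivAt_pow 2 (0 : ℝ))).const_mul ε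
    simpa using h
  have h0 := hmin.hasDerivAt_eq_zero ((hexp.sub hmean).add hpen)
  simp only [zero_mul, add_zero, Finset.sum_div] at h0
  simp only [sub_mul, Finset.sum_sub_distrib, div_mul_eq_mul_div]
  linarith

theorem exists_mem_expFam_moment_sq_le (A : X → Fin d → ℝ) {p : X → ℝ} (hp : IsDist p) {ε : ℝ}
    (hε : 0 < ε) : ∃ q ∈ expFam A, ∀ k,
      (∑ x, (q x - p x) * A x k) ^ 2 ≤ ε * (4 * Real.log (Fintype.card X)) := by
  have := hp.nonempty
  obtain ⟨θ, hθ⟩ := exists_forall_penalizedLoss_le A hp hε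
  refine ⟨_, ⟨θ, fun x => rfl⟩, fun k => ?_⟩
  rw [penalizedLoss_stationary A p ε hθ k]
  have h := (mul_sq_le_penalizedLoss A hp hε θ k).trans (hθ 0)
  rw [penalizedLoss_zero] at h
  nlinarith [mul_le_mul_of_nonneg_left h hε.le]

/-- Every distribution has the same moments as some element of the closure of the exponential
family. -/
theorem exists_mem_closure_expFam_moment_eq (A : X → Fin d → ℝ) {p : X → ℝ} (hp : IsDist p) :
    ∃ q ∈ closure (expFam A), (∀ x, 0 ≤ q x) ∧ ∀ k, ∑ x, (q x - p x) * A x k = 0 := by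
  have := hp.nonempty
  choose q hq hmom using fun n : ℕ =>
    exists_mem_expFam_moment_sq_le A hp (Nat.one_div_pos_of_nat (α := ℝ) (n := n))
  obtain ⟨r, hr, φ, hφ, hlim⟩ := (isCompact_stdSimplex ℝ X).tendsto_subseq
    fun n => expFam_subset_stdSimplex A (hq n)
  refine ⟨r, mem_closure_of_tendsto hlim (Eventually.of_forall fun n => hq _), hr.1, fun k => ?_⟩
  have hcont : Continuous fun s : X → ℝ => (∑ x, (s x - p x) * A x k) ^ 2 := by fun_prop
  have hzero : Tendsto (fun n : ℕ => 1 / ((n : ℝ) + 1) * (4 * Real.log (Fintype.card X)))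
      atTop (𝓝 0) := by
    simpa using tendsto_one_div_add_atTop_nhds_zero_nat.mul_const (4 * Real.log (Fintype.card X))
  have h := le_of_tendsto_of_tendsto' ((hcont.tendsto r).comp hlim)
    (hzero.comp hφ.tendsto_atTop) fun n => hmom (φ n) k
  exact pow_eq_zero_iff two_ne_zero |>.1 (le_antisymm h (sq_nonneg _))

/-- Binomial-type equations with real exponents hold on the closure of the exponential family. -/
theorem prod_rpow_eq_of_mem_closure_expFam [Nonempty X] {A : X → Fin d → ℝ}
    {c : Fin d → ℝ} (hc : ∀ x, ∑ j, c j * A x j = 1) {m : X → ℝ}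
    (hm : ∀ j, ∑ x, m x * A x j = 0) {q : X → ℝ} (hq : q ∈ closure (expFam A)) :
    ∏ x, q x ^ (m x ⊔ 0) = ∏ x, q x ^ (-m x ⊔ 0) := by
  have hdot (θ : Fin d → ℝ) : ∑ x, m x * ∑ j, θ j * A x j = 0 := by
    simp_rw [Finset.mul_sum]
    rw [Finset.sum_comm]
    refine Finset.sum_eq_zero fun j _ => ?_
    rw [← mul_zero (θ j), ← hm j, Finset.mul_sum]
    exact Finset.sum_congr rfl fun x _ => by ring
  have hsum : ∑ x, m x = 0 := by simpa [hc] using hdot c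
  have hclosed : IsClosed {q : X → ℝ | ∏ x, q x ^ (m x ⊔ 0) = ∏ x, q x ^ (-m x ⊔ 0)} := by
    refine isClosed_eq ?_ ?_ <;>
    exact continuous_finsetProd _ fun x _ =>
      (Real.continuous_rpow_const (le_max_right _ _)).comp (continuous_apply x)
  refine closure_minimal (fun s hs => ?_) hclosed hq
  have hpos := expFam_pos hs
  obtain ⟨θ, hθ⟩ := hs
  have hlog : ∑ x, m x * Real.log (s x) = 0 := by
    simp_rw [hθ, Real.log_div (Real.exp_pos _).ne' (sum_exp_pos _).ne', Real.log_exp, mul_sub,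
      Finset.sum_sub_distrib, ← Finset.sum_mul, hdot, hsum]
    simp
  have hprod (f : X → ℝ) : ∏ x, s x ^ f x = Real.exp (∑ x, f x * Real.log (s x)) := by
    rw [Real.exp_sum]
    exact Finset.prod_congr rfl fun x _ => by rw [Real.rpow_def_of_pos (hpos x), mul_comm]
  change ∏ x, s x ^ (m x ⊔ 0) = ∏ x, s x ^ (-m x ⊔ 0)
  rw [hprod, hprod]
  congr 1
  rw [← sub_eq_zero, ← Finset.sum_sub_distrib]
  refine Eq.trans ?_ hlog
  refine Finset.sum_congr rfl fun x _ => ?_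
  rw [← sub_mul]
  congr 1
  rcases le_total 0 (m x) with h | h
  · rw [max_eq_left h, max_eq_right (by linarith), sub_zero]
  · rw [max_eq_right h, max_eq_left (by linarith)]; ring

/-- A distribution supported in `Y` is a limit of distributions with support exactly `Y`. -/
theorem IsDist.mem_closure_support_eq {p : X → ℝ} (hp : IsDist p) {Y : Set X}
    (hY : {x | 0 < p x} ⊆ Y) : p ∈ closure {q | IsDist q ∧ {x | 0 < q x} = Y} := by
  classical
  have hzero : ∀ x ∉ Y, p x = 0 := fun x hx =>
    le_antisymm (not_lt.1 fun h => hx (hY h)) (hp.1 x)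
  have hne : Y.Nonempty := by
    by_contra h
    rw [Set.not_nonempty_iff_eq_empty] at h
    have h1 := hp.2
    simp [hzero, h] at h1
  have hcard : 0 < (Y.toFinset.card : ℝ) := by
    exact_mod_cast Finset.card_pos.2 (Set.toFinset_nonempty.2 hne)
  let u : X → ℝ := fun x => if x ∈ Y then (Y.toFinset.card : ℝ)⁻¹ else 0
  have hu0 (x : X) : 0 ≤ u x := by
    simp only [u]; split_ifs <;> positivity
  have hu1 : ∑ x, u x = 1 := by
    have h : ∑ x, u x = ∑ x ∈ Y.toFinset, (Y.toFinset.card : ℝ)⁻¹ := by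
      rw [← Finset.sum_filter]
      congr 1
      ext; simp
    rw [h, Finset.sum_const, nsmul_eq_mul, mul_inv_cancel₀ hcard.ne']
  have hcont : Continuous fun t : ℝ => fun x => (1 - t) * p x + t * u x := by fun_prop
  have hlim : Tendsto (fun t : ℝ => fun x => (1 - t) * p x + t * u x) (𝓝[>] 0) (𝓝 p) := by
    have h := (hcont.tendsto 0).mono_left (nhdsWithin_le_nhds (s := Set.Ioi 0))
    simpa using h
  refine mem_closure_of_tendsto hlim ?_
  filter_upwards [Ioo_mem_nhdsGT (zero_lt_one' ℝ)] with t ht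
  have ht1 : 0 ≤ 1 - t := by linarith [ht.2]
  have hpt (x : X) : 0 ≤ (1 - t) * p x := mul_nonneg ht1 (hp.1 x)
  refine ⟨⟨fun x => add_nonneg (hpt x) (mul_nonneg ht.1.le (hu0 x)), ?_⟩, ?_⟩
  · rw [Finset.sum_add_distrib, ← Finset.mul_sum, ← Finset.mul_sum, hp.2, hu1]
    ring
  · ext x
    by_cases hx : x ∈ Y
    · have hux : 0 < u x := by simp only [u, if_pos hx]; positivity
      simpa [hx] using add_pos_of_nonneg_of_pos (hpt x) (mul_pos ht.1 hux)
    · simp [hx, u, hzero x hx]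

end

/-- equivalence of (a) every distribution with support equal to
`Y` lies in the closure of `E_A`, (b) every distribution with support contained
in `Y` lies in the closure of `E_A`, and (c) no nonzero `μ` with
`∑ x, μ x • A x = 0` has its positive part supported in `Y`. -/
theorem stmt_10 {X : Type*} [Fintype X] {d : ℕ} (A : X → Fin d → ℝ)
    (hc : ∃ c : Fin d → ℝ, ∀ x, ∑ j, c j * A x j = 1) (Y : Set X) :
    ((∀ p : X → ℝ, IsDist p → {x | 0 < p x} = Y → p ∈ closure (expFam A)) ↔
      (∀ p : X → ℝ, IsDist p → {x | 0 < p x} ⊆ Y → p ∈ closure (expFam A))) ∧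
    ((∀ p : X → ℝ, IsDist p → {x | 0 < p x} ⊆ Y → p ∈ closure (expFam A)) ↔
      (∀ μ : X → ℝ, μ ≠ 0 → (∀ j, ∑ x, μ x * A x j = 0) →
        ¬ {x | 0 < μ x} ⊆ Y)) := by
  refine ⟨⟨fun h p hp hpY => ?_, fun h p hp hpY => h p hp hpY.le⟩,
    fun h m hm hmA hmY => ?_, fun h p hp hpY => ?_⟩
  · exact closure_minimal (fun q hq => h q hq.1 hq.2) isClosed_closure
      (hp.mem_closure_support_eq hpY)
  · obtain ⟨c, hc⟩ := hc
    have hsum : ∑ x, m x = 0 := by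
      have h1 : ∑ x, m x = ∑ x, ∑ j, c j * (m x * A x j) := by
        simp_rw [mul_left_comm (c _), ← Finset.mul_sum, hc, mul_one]
      rw [h1, Finset.sum_comm]
      simp [← Finset.mul_sum, hmA]
    obtain ⟨y, hy⟩ : ∃ y, m y < 0 := by
      by_contra! hnonneg
      exact hm (funext fun x =>
        (Finset.sum_eq_zero_iff_of_nonneg fun x _ => hnonneg x).1 hsum x (Finset.mem_univ x))
    obtain ⟨z, hz⟩ : ∃ z, 0 < m z := by
      by_contra! hnonpos
      exact hy.ne ((Finset.sum_eq_zero_iff_of_nonpos fun x _ => hnonpos x).1 hsum y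
        (Finset.mem_univ y))
    have : Nonempty X := ⟨y⟩
    set S := ∑ x, m x ⊔ 0 with hS
    have hSpos : 0 < S := Finset.sum_pos' (fun x _ => le_max_right _ _)
      ⟨z, Finset.mem_univ z, lt_max_of_lt_left hz⟩
    have hsupp (x : X) : 0 < (m x ⊔ 0) / S ↔ 0 < m x := by
      rw [div_pos_iff_of_pos_right hSpos]
      simp
    have hmem := h (fun x => (m x ⊔ 0) / S)
      ⟨fun x => div_nonneg (le_max_right _ _) hSpos.le, by
        rw [← Finset.sum_div]; exact div_self hSpos.ne'⟩
      (by simpa only [hsupp] using hmY)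
    have hprod := prod_rpow_eq_of_mem_closure_expFam hc hmA hmem
    have hright : ∏ x, ((m x ⊔ 0) / S) ^ (-m x ⊔ 0) = 0 := by
      refine Finset.prod_eq_zero (Finset.mem_univ y) ?_
      rw [max_eq_right hy.le, zero_div, Real.zero_rpow]
      exact (lt_max_of_lt_left (neg_pos.2 hy)).ne'
    refine (Finset.prod_pos fun x _ => ?_).ne' (hprod.trans hright)
    rcases le_or_gt (m x) 0 with hx | hx
    · simp [max_eq_right hx]
    · exact Real.rpow_pos_of_pos ((hsupp x).2 hx) _
  · obtain ⟨q, hq, hq0, hqA⟩ := exists_mem_closure_expFam_moment_eq A hp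
    by_contra hpcl
    refine h (fun x => p x - q x) (fun h0 => hpcl ?_) (fun j => ?_) fun x hx => hpY ?_
    · rwa [show p = q from funext fun x => sub_eq_zero.1 (congrFun h0 x)]
    · rw [← neg_eq_zero, ← hqA j, ← Finset.sum_neg_distrib]
      exact Finset.sum_congr rfl fun x _ => by ring
    · exact (hq0 x).trans_lt (sub_pos.1 hx)
end

section
/- Let 0 < k < N, let λ ⊆ {1,…,N} with |λ| = k+1, let y ∈ {0,1}^N, and let C = {x ∈ {0,1}^N : x_j = y_j for all j ∉ λ}. Then there exists a probability distribution p on {0,1}^N with supp(p) ⊆ C ∩ Z_+ that does not lie in the closure of the k-interaction exponential family E^k; consequently, no set Y ⊆ {0,1}^N with Y ⊇ C ∩ Z_+ is an S-set for E^k. The same holds with Z_− in place of Z_+. -/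
/-- The `k`-interaction exponential family on `{0,1}^N`. -/
abbrev EkBin (N k : ℕ) : Set ((Fin N → Fin 2) → ℝ) := interactionFamily k

/-- `Y` is an S-set for the family `E`: every distribution supported in `Y`
lies in the closure of `E`. -/
def IsSSet {X : Type*} [Fintype X] (E : Set (X → ℝ)) (Y : Set X) : Prop :=
  ∀ p : X → ℝ, IsDist p → {x | 0 < p x} ⊆ Y → p ∈ closure E

/-- Flip the `i`-th bit of a binary vector. -/
def flipBit {N : ℕ} (i : Fin N) (x : Fin N → Fin 2) : Fin N → Fin 2 :=
  Function.update x i (1 - x i)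

theorem flipBit_of_ne {N : ℕ} {i j : Fin N} (h : j ≠ i) (x : Fin N → Fin 2) :
    flipBit i x j = x j := by
  simp [flipBit, h]

theorem flipBit_flipBit {N : ℕ} (i : Fin N) (x : Fin N → Fin 2) :
    flipBit i (flipBit i x) = x := by
  simp [flipBit]

theorem even_sum_flipBit_iff {N : ℕ} (i : Fin N) (x : Fin N → Fin 2) :
    Even (∑ j, (flipBit i x j : ℕ)) ↔ ¬ Even (∑ j, (x j : ℕ)) := by
  have hrest : ∑ j ∈ Finset.univ.erase i, (flipBit i x j : ℕ) =
      ∑ j ∈ Finset.univ.erase i, (x j : ℕ) :=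
    Finset.sum_congr rfl fun j hj => by rw [flipBit_of_ne (Finset.ne_of_mem_erase hj)]
  rw [← Finset.add_sum_erase _ (fun j => (flipBit i x j : ℕ)) (Finset.mem_univ i),
    ← Finset.add_sum_erase _ (fun j => (x j : ℕ)) (Finset.mem_univ i), hrest]
  have hi : flipBit i x i = 1 - x i := by simp [flipBit]
  simp only [hi]
  generalize x i = b
  fin_cases b <;> simp [Nat.even_add, Nat.even_add_one]

theorem sum_even_eq_sum_odd_of_dependsOnlyOn {N : ℕ} {lam s : Finset (Fin N)}
    (y : Fin N → Fin 2) (hs : s.card < lam.card) {g : (Fin N → Fin 2) → ℝ}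
    (hg : DependsOnlyOn s g) :
    ∑ x with (∀ j ∉ lam, x j = y j) ∧ Even (∑ i, (x i : ℕ)), g x =
      ∑ x with (∀ j ∉ lam, x j = y j) ∧ ¬ Even (∑ i, (x i : ℕ)), g x := by
  obtain ⟨i, hi, his⟩ := Finset.exists_mem_notMem_of_card_lt_card hs
  have hC : ∀ x : Fin N → Fin 2, (∀ j ∉ lam, x j = y j) → ∀ j ∉ lam, flipBit i x j = y j :=
    fun x hx j hj => by rw [flipBit_of_ne (ne_of_mem_of_not_mem hi hj).symm, hx j hj]
  refine Finset.sum_bij' (fun x _ => flipBit i x) (fun x _ => flipBit i x) ?_ ?_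
    (fun x _ => flipBit_flipBit i x) (fun x _ => flipBit_flipBit i x) ?_
  · intro x hx
    simp only [Finset.mem_filter, Finset.mem_univ, true_and, even_sum_flipBit_iff,
      not_not] at hx ⊢
    exact ⟨hC x hx.1, hx.2⟩
  · intro x hx
    simp only [Finset.mem_filter, Finset.mem_univ, true_and, even_sum_flipBit_iff] at hx ⊢
    exact ⟨hC x hx.1, hx.2⟩
  · intro x _
    exact hg _ _ fun j hj => (flipBit_of_ne (ne_of_mem_of_not_mem hj his) x).symm

theorem prod_even_eq_prod_odd_of_mem_interactionFamily {N k : ℕ} {lam : Finset (Fin N)}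
    (hlam : k < lam.card) (y : Fin N → Fin 2) {q : (Fin N → Fin 2) → ℝ} (hq : q ∈ EkBin N k) :
    ∏ x with (∀ j ∉ lam, x j = y j) ∧ Even (∑ i, (x i : ℕ)), q x =
      ∏ x with (∀ j ∉ lam, x j = y j) ∧ ¬ Even (∑ i, (x i : ℕ)), q x := by
  obtain ⟨F, hF, hF0, hqF⟩ := hq
  have hZ : 0 < ∑ y, Real.exp (∑ s, F s y) :=
    Finset.sum_pos (fun _ _ => Real.exp_pos _) Finset.univ_nonempty
  have hexp : ∀ x, q x = Real.exp (∑ s, F s x - Real.log (∑ y, Real.exp (∑ s, F s y))) :=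
    fun x => by rw [hqF, Real.exp_sub, Real.exp_log hZ]
  simp only [hexp, ← Real.exp_sum, Finset.sum_sub_distrib]
  congr 2
  · rw [Finset.sum_comm, Finset.sum_comm (t := Finset.univ)]
    refine Finset.sum_congr rfl fun s _ => ?_
    rcases lt_or_ge k s.card with hs | hs
    · simp [hF0 s hs]
    · exact sum_even_eq_sum_odd_of_dependsOnlyOn y (hs.trans_lt hlam) (hF s)
  · exact sum_even_eq_sum_odd_of_dependsOnlyOn (s := ∅) y (by simpa using hlam.pos)
      fun _ _ _ => rfl

/-- If every member of a family assigns equal products to two disjoint nonempty finite sets, then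
the uniform distribution on the first set is outside the closure of the family. -/
theorem exists_isDist_notMem_closure {X : Type*} [Fintype X] {E : Set (X → ℝ)} {A B : Finset X}
    (hA : A.Nonempty) (hB : B.Nonempty) (hAB : Disjoint A B)
    (hE : ∀ q ∈ E, ∏ x ∈ A, q x = ∏ x ∈ B, q x) :
    ∃ p : X → ℝ, IsDist p ∧ {x | 0 < p x} ⊆ A ∧ p ∉ closure E := by
  classical
  have hcard : (0 : ℝ) < A.card := by exact_mod_cast hA.card_pos
  refine ⟨fun x => if x ∈ A then (A.card : ℝ)⁻¹ else 0, ⟨fun x => ?_, ?_⟩, fun x hx => ?_,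
    fun hp => ?_⟩
  · dsimp only
    split_ifs <;> positivity
  · simp [hcard.ne']
  · by_contra hxA
    simp only [Finset.mem_coe] at hxA
    simp [hxA] at hx
  · have hclosed : IsClosed {q : X → ℝ | ∏ x ∈ A, q x = ∏ x ∈ B, q x} :=
      isClosed_eq (by fun_prop) (by fun_prop)
    have heq := closure_minimal hE hclosed hp
    obtain ⟨b, hb⟩ := hB
    change ∏ x ∈ A, _ = ∏ x ∈ B, _ at heq
    rw [Finset.prod_eq_zero hb (if_neg (Finset.disjoint_right.mp hAB hb))] at heq
    refine (Finset.prod_pos fun x hx => ?_).ne' heq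
    rw [if_pos hx]
    positivity

/-- for a `(k+1)`-dimensional cylinder set `C`, there is a
distribution supported in `C ∩ Z₊` outside the closure of `E^k`; hence no
superset of `C ∩ Z₊` is an S-set for `E^k`; and the same with `Z₋`. -/
theorem stmt_12 (N k : ℕ) (hk : 0 < k) (hkN : k < N)
    (lam : Finset (Fin N)) (hlam : lam.card = k + 1) (y : Fin N → Fin 2) :
    let C : Set (Fin N → Fin 2) := {x | ∀ j ∉ lam, x j = y j}
    ((∃ p : (Fin N → Fin 2) → ℝ, IsDist p ∧ {x | 0 < p x} ⊆ C ∩ Zplus N ∧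
        p ∉ closure (EkBin N k)) ∧
      ∀ Y : Set (Fin N → Fin 2), C ∩ Zplus N ⊆ Y → ¬ IsSSet (EkBin N k) Y) ∧
    ((∃ p : (Fin N → Fin 2) → ℝ, IsDist p ∧ {x | 0 < p x} ⊆ C ∩ Zminus N ∧
        p ∉ closure (EkBin N k)) ∧
      ∀ Y : Set (Fin N → Fin 2), C ∩ Zminus N ⊆ Y → ¬ IsSSet (EkBin N k) Y) := by
  intro C
  obtain ⟨i, hi⟩ : lam.Nonempty := Finset.card_pos.mp (by omega)
  have hflip : ∀ j ∉ lam, flipBit i y j = y j :=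
    fun j hj => flipBit_of_ne (ne_of_mem_of_not_mem hi hj).symm y
  have hE := fun q (hq : q ∈ EkBin N k) =>
    prod_even_eq_prod_odd_of_mem_interactionFamily (lam := lam) (by omega) y hq
  set A : Finset (Fin N → Fin 2) :=
    {x | (∀ j ∉ lam, x j = y j) ∧ Even (∑ i, (x i : ℕ))}
  set B : Finset (Fin N → Fin 2) :=
    {x | (∀ j ∉ lam, x j = y j) ∧ ¬ Even (∑ i, (x i : ℕ))}
  have hA : A.Nonempty := by
    by_cases h : Even (∑ i, (y i : ℕ))
    · exact ⟨y, Finset.mem_filter.mpr ⟨Finset.mem_univ _, fun _ _ => rfl, h⟩⟩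
    · exact ⟨flipBit i y, Finset.mem_filter.mpr
        ⟨Finset.mem_univ _, hflip, (even_sum_flipBit_iff i y).mpr h⟩⟩
  have hB : B.Nonempty := by
    by_cases h : Even (∑ i, (y i : ℕ))
    · refine ⟨flipBit i y, Finset.mem_filter.mpr ⟨Finset.mem_univ _, hflip, ?_⟩⟩
      rwa [even_sum_flipBit_iff, not_not]
    · exact ⟨y, Finset.mem_filter.mpr ⟨Finset.mem_univ _, fun _ _ => rfl, h⟩⟩
  have hAB : Disjoint A B := Finset.disjoint_left.mpr fun x hxA hxB =>
    (Finset.mem_filter.mp hxB).2.2 (Finset.mem_filter.mp hxA).2.2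
  obtain ⟨p, hp, hpA, hpE⟩ := exists_isDist_notMem_closure hA hB hAB hE
  obtain ⟨r, hr, hrB, hrE⟩ :=
    exists_isDist_notMem_closure hB hA hAB.symm fun q hq => (hE q hq).symm
  have hpC : {x | 0 < p x} ⊆ C ∩ Zplus N := fun x hx => (Finset.mem_filter.mp (hpA hx)).2
  have hrC : {x | 0 < r x} ⊆ C ∩ Zminus N := fun x hx => (Finset.mem_filter.mp (hrB hx)).2
  exact ⟨⟨⟨p, hp, hpC, hpE⟩, fun Y hY hS => hpE (hS p hp (hpC.trans hY))⟩,
    ⟨⟨r, hr, hrC, hrE⟩, fun Y hY hS => hrE (hS r hr (hrC.trans hY))⟩⟩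
end

section
/- Let 0 < k < N, let λ ⊆ {1,…,N} with |λ| = k+1, let y ∈ {0,1}^N, and let C = {x ∈ {0,1}^N : x_j = y_j for all j ∉ λ}. If Y ⊆ {0,1}^N satisfies Y ⊇ C ∩ Z_+ and C ⊄ Y, then no element of the closure of the k-interaction exponential family E^k has support equal to Y (i.e., Y is not a facial set of E^k). The same holds with Z_− in place of Z_+. -/
open Finset in
theorem even_sum_update_one_sub_iff {N : ℕ} (x : Fin N → Fin 2) (j : Fin N) :
    Even (∑ i, (Function.update x j (1 - x j) i : ℕ)) ↔ ¬ Even (∑ i, (x i : ℕ)) := by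
  have hrest : ∑ i ∈ univ.erase j, (Function.update x j (1 - x j) i : ℕ) =
      ∑ i ∈ univ.erase j, (x i : ℕ) :=
    sum_congr rfl fun i hi => by rw [Function.update_of_ne (ne_of_mem_erase hi)]
  rw [← add_sum_erase univ _ (mem_univ j), ← add_sum_erase univ (fun i => (x i : ℕ)) (mem_univ j),
    hrest, Function.update_self]
  generalize x j = a
  fin_cases a <;> simp [Nat.even_add, parity_simps]

/-- The sums over the even and the odd points of a cylinder set agree for a function which ignores
one of the free coordinates of the cylinder set. -/
theorem sum_cylinder_even_eq_sum_cylinder_odd {N : ℕ} {lam s : Finset (Fin N)}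
    (hs : s.card < lam.card) (y : Fin N → Fin 2) {h : (Fin N → Fin 2) → ℝ}
    (hh : DependsOnlyOn s h) :
    ∑ x with (∀ j ∉ lam, x j = y j) ∧ Even (∑ i, (x i : ℕ)), h x =
      ∑ x with (∀ j ∉ lam, x j = y j) ∧ ¬ Even (∑ i, (x i : ℕ)), h x := by
  obtain ⟨j, hj, hjs⟩ := Finset.exists_mem_notMem_of_card_lt_card hs
  have hflip : ∀ x : Fin N → Fin 2, (∀ i ∉ lam, x i = y i) →
      ∀ i ∉ lam, Function.update x j (1 - x j) i = y i := fun x hx i hi => by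
    rw [Function.update_of_ne (by rintro rfl; exact hi hj), hx i hi]
  have hinv : ∀ x : Fin N → Fin 2, Function.update (Function.update x j (1 - x j)) j
      (1 - Function.update x j (1 - x j) j) = x := fun x => by simp
  refine Finset.sum_nbij' (fun x => Function.update x j (1 - x j))
    (fun x => Function.update x j (1 - x j)) ?_ ?_ (fun x _ => hinv x) (fun x _ => hinv x) ?_
  · intro x hx
    rw [Finset.mem_filter] at hx ⊢
    exact ⟨Finset.mem_univ _, hflip x hx.2.1,
      fun he => (even_sum_update_one_sub_iff x j).1 he hx.2.2⟩
  · intro x hx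
    rw [Finset.mem_filter] at hx ⊢
    exact ⟨Finset.mem_univ _, hflip x hx.2.1, (even_sum_update_one_sub_iff x j).2 hx.2.2⟩
  · intro x _
    exact hh _ _ fun i hi => by rw [Function.update_of_ne (by rintro rfl; exact hjs hi)]

theorem prod_cylinder_even_eq_prod_cylinder_odd_of_mem {N k : ℕ} {lam : Finset (Fin N)}
    (hlam : k < lam.card) (y : Fin N → Fin 2) {p : (Fin N → Fin 2) → ℝ} (hp : p ∈ EkBin N k) :
    ∏ x with (∀ j ∉ lam, x j = y j) ∧ Even (∑ i, (x i : ℕ)), p x =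
      ∏ x with (∀ j ∉ lam, x j = y j) ∧ ¬ Even (∑ i, (x i : ℕ)), p x := by
  obtain ⟨F, hF, hF0, hp⟩ := hp
  have hexp : ∀ x, p x = Real.exp (∑ s, F s x - Real.log (∑ z, Real.exp (∑ s, F s z))) := by
    intro x
    rw [hp, Real.exp_sub, Real.exp_log (Finset.sum_pos (fun _ _ => Real.exp_pos _)
      Finset.univ_nonempty)]
  generalize Real.log (∑ z, Real.exp (∑ s, F s z)) = c at hexp
  simp_rw [hexp, ← Real.exp_sum, Finset.sum_sub_distrib]
  congr 2
  · rw [Finset.sum_comm, Finset.sum_comm (t := Finset.univ)]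
    refine Finset.sum_congr rfl fun s _ => ?_
    by_cases hs : k < s.card
    · simp [hF0 s hs]
    · exact sum_cylinder_even_eq_sum_cylinder_odd (by lia) y (hF s)
  · exact sum_cylinder_even_eq_sum_cylinder_odd (s := ∅) (by rw [Finset.card_empty]; lia) y (fun _ _ _ => rfl)

theorem prod_cylinder_even_eq_prod_cylinder_odd {N k : ℕ} {lam : Finset (Fin N)}
    (hlam : k < lam.card) (y : Fin N → Fin 2) {g : (Fin N → Fin 2) → ℝ}
    (hg : g ∈ closure (EkBin N k)) :
    ∏ x with (∀ j ∉ lam, x j = y j) ∧ Even (∑ i, (x i : ℕ)), g x =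
      ∏ x with (∀ j ∉ lam, x j = y j) ∧ ¬ Even (∑ i, (x i : ℕ)), g x :=
  closure_minimal
    (t := {g : (Fin N → Fin 2) → ℝ | ∏ x with (∀ j ∉ lam, x j = y j) ∧ Even (∑ i, (x i : ℕ)), g x =
      ∏ x with (∀ j ∉ lam, x j = y j) ∧ ¬ Even (∑ i, (x i : ℕ)), g x})
    (fun _ hp => prod_cylinder_even_eq_prod_cylinder_odd_of_mem hlam y hp)
    (isClosed_eq (by fun_prop) (by fun_prop)) hg

theorem nonneg_of_mem_closure_interactionFamily {k N : ℕ} {X : Fin N → Type*} [∀ i, Fintype (X i)]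
    {g : ((i : Fin N) → X i) → ℝ} (hg : g ∈ closure (interactionFamily k)) : 0 ≤ g := by
  refine closure_minimal (t := Set.Ici 0) ?_ isClosed_Ici hg
  rintro p ⟨F, -, -, hp⟩ x
  rw [hp]
  exact div_nonneg (Real.exp_pos _).le (Finset.sum_nonneg fun _ _ => (Real.exp_pos _).le)

/-- If two products of nonnegative numbers agree and all factors of the first are positive, so are
all factors of the second. -/
theorem pos_of_prod_eq_prod {ι : Type*} {s t : Finset ι} {g : ι → ℝ} (hg : 0 ≤ g)
    (hst : ∏ x ∈ s, g x = ∏ x ∈ t, g x) (hs : ∀ x ∈ s, 0 < g x) : ∀ x ∈ t, 0 < g x := by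
  intro x hx
  have ht : ∏ x ∈ t, g x ≠ 0 := hst ▸ (Finset.prod_pos hs).ne'
  exact (hg x).lt_of_ne' (Finset.prod_ne_zero_iff.1 ht x hx)

/-- if `Y` contains `C ∩ Z₊` (or `C ∩ Z₋`) for a
`(k+1)`-dimensional cylinder set `C` but does not contain all of `C`, then `Y`
is not the support of any element of the closure of `E^k`. -/
theorem stmt_13 (N k : ℕ) (hk : 0 < k) (hkN : k < N)
    (lam : Finset (Fin N)) (hlam : lam.card = k + 1) (y : Fin N → Fin 2)
    (Y : Set (Fin N → Fin 2))
    (hY : {x | ∀ j ∉ lam, x j = y j} ∩ Zplus N ⊆ Y ∨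
      {x | ∀ j ∉ lam, x j = y j} ∩ Zminus N ⊆ Y)
    (hnotC : ¬ {x : Fin N → Fin 2 | ∀ j ∉ lam, x j = y j} ⊆ Y) :
    ∀ g ∈ closure (EkBin N k), {x | 0 < g x} ≠ Y := by
  rintro g hg rfl
  have hprod := prod_cylinder_even_eq_prod_cylinder_odd (lam := lam) (by lia) y hg
  have hnonneg : 0 ≤ g := nonneg_of_mem_closure_interactionFamily hg
  refine hnotC fun x hx => ?_
  rcases hY with hY | hY
  · by_cases he : Even (∑ i, (x i : ℕ))
    · exact hY ⟨hx, he⟩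
    · exact pos_of_prod_eq_prod hnonneg hprod
        (fun z hz => hY (Finset.mem_filter.1 hz).2) x
        (Finset.mem_filter.2 ⟨Finset.mem_univ _, hx, he⟩)
  · by_cases he : Even (∑ i, (x i : ℕ))
    · exact pos_of_prod_eq_prod hnonneg hprod.symm
        (fun z hz => hY (Finset.mem_filter.1 hz).2) x
        (Finset.mem_filter.2 ⟨Finset.mem_univ _, hx, he⟩)
    · exact hY ⟨hx, he⟩
end

section
/- Let 0 < k < N and let K denote the minimal cardinality of a set M ⊆ {0,1}^N such that every cylinder set of dimension k+1 contains an element of M. If Y ⊆ {0,1}^N is an S-set for the k-interaction exponential family E^k, then |Y ∩ Z_+| ≤ 2^{N−1} − K and |Y ∩ Z_−| ≤ 2^{N−1} − K, hence |Y| ≤ 2^N − 2K; moreover |Y| ≤ ∑_{i=0}^k binom(N, i). -/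
/-- A real weight `n` is orthogonal to every interaction of order at most `k`. -/
def OrthInteractions (k : ℕ) {N : ℕ} {X : Fin N → Type*} [∀ i, Fintype (X i)]
    (n : ((i : Fin N) → X i) → ℝ) : Prop :=
  ∀ (s : Finset (Fin N)) (g : ((i : Fin N) → X i) → ℝ), s.card ≤ k → DependsOnlyOn s g →
    ∑ x, n x * g x = 0

section General

variable {k N : ℕ} {X : Fin N → Type*} [∀ i, Fintype (X i)] {n : ((i : Fin N) → X i) → ℝ}

theorem OrthInteractions.neg (hn : OrthInteractions k n) : OrthInteractions k (-n) := by
  intro s g hs hg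
  simpa using hn s g hs hg

theorem OrthInteractions.sum_eq_zero (hn : OrthInteractions k n) : ∑ x, n x = 0 := by
  simpa using hn ∅ (fun _ => 1) (by simp) (fun _ _ _ => rfl)

theorem OrthInteractions.prod_rpow_eq_of_mem (hn : OrthInteractions k n)
    {p : ((i : Fin N) → X i) → ℝ} (hp : p ∈ interactionFamily k) :
    ∏ x, p x ^ (max (n x) 0) = ∏ x, p x ^ (max (-n x) 0) := by
  obtain ⟨F, hF, hFk, hpF⟩ := hp
  let Z := ∑ y, Real.exp (∑ s, F s y)
  have hZpos (x : (i : Fin N) → X i) : 0 < Z :=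
    Finset.sum_pos (fun _ _ => Real.exp_pos _) ⟨x, Finset.mem_univ x⟩
  have hexp (x) : p x = Real.exp (∑ s, F s x - Real.log Z) := by
    rw [hpF, Real.exp_sub, Real.exp_log (hZpos x)]
  have horth : ∑ x, n x * (∑ s, F s x - Real.log Z) = 0 := by
    simp only [mul_sub, Finset.sum_sub_distrib, ← Finset.sum_mul, hn.sum_eq_zero, zero_mul,
      sub_zero, Finset.mul_sum]
    rw [Finset.sum_comm]
    refine Finset.sum_eq_zero fun s _ => ?_
    rcases le_or_gt s.card k with hs | hs
    · exact hn s (F s) hs (hF s)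
    · simp [hFk s hs]
  simp only [hexp, ← Real.exp_mul, ← Real.exp_sum]
  congr 1
  rw [← sub_eq_zero, ← Finset.sum_sub_distrib]
  refine Eq.trans ?_ horth
  refine Finset.sum_congr rfl fun x _ => ?_
  rw [← mul_sub, mul_comm]
  congr 1
  rcases le_total (n x) 0 with h | h
  · rw [max_eq_right h, max_eq_left (by linarith)]; ring
  · rw [max_eq_left h, max_eq_right (by linarith)]; ring

theorem OrthInteractions.prod_rpow_eq_of_mem_closure (hn : OrthInteractions k n)
    {p : ((i : Fin N) → X i) → ℝ} (hp : p ∈ closure (interactionFamily k)) :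
    ∏ x, p x ^ (max (n x) 0) = ∏ x, p x ^ (max (-n x) 0) := by
  have hclosed : IsClosed {p : ((i : Fin N) → X i) → ℝ |
      ∏ x, p x ^ (max (n x) 0) = ∏ x, p x ^ (max (-n x) 0)} :=
    isClosed_eq
      (continuous_finsetProd _ fun x _ =>
        (continuous_apply x).rpow_const fun _ => Or.inr (le_max_right _ _))
      (continuous_finsetProd _ fun x _ =>
        (continuous_apply x).rpow_const fun _ => Or.inr (le_max_right _ _))
  exact closure_minimal (fun _ hq => hn.prod_rpow_eq_of_mem hq) hclosed hp

/-- An S-set does not contain the positive part of a nonzero weight orthogonal to the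
interactions. -/
theorem OrthInteractions.exists_pos_notMem (hn : OrthInteractions k n) (hpos : ∃ x, 0 < n x)
    {Y : Set ((i : Fin N) → X i)} (hY : IsSSet (interactionFamily k) Y) :
    ∃ x, 0 < n x ∧ x ∉ Y := by
  by_contra! hsub
  obtain ⟨a, ha⟩ := hpos
  obtain ⟨b, hb⟩ : ∃ b, n b < 0 := by
    by_contra! hnonneg
    exact ha.ne' ((Finset.sum_eq_zero_iff_of_nonneg fun x _ => hnonneg x).1 hn.sum_eq_zero a
      (Finset.mem_univ a))
  set S := ∑ x, max (n x) 0
  have hSpos : 0 < S := (lt_max_of_lt_left ha).trans_le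
    (Finset.single_le_sum (f := fun x => max (n x) 0) (fun _ _ => le_max_right _ _)
      (Finset.mem_univ a))
  let p : ((i : Fin N) → X i) → ℝ := fun x => max (n x) 0 / S
  have hsupp (x) (hx : 0 < p x) : 0 < n x := by
    have h : 0 < max (n x) 0 := (div_pos_iff_of_pos_right hSpos).1 hx
    simpa using h
  have hp : p ∈ closure (interactionFamily k) := hY p
    ⟨fun x => div_nonneg (le_max_right _ _) hSpos.le, by
      rw [← Finset.sum_div, div_self hSpos.ne']⟩
    fun x hx => hsub x (hsupp x hx)
  have heq := hn.prod_rpow_eq_of_mem_closure hp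
  have hright : ∏ x, p x ^ (max (-n x) 0) = 0 := by
    refine Finset.prod_eq_zero (Finset.mem_univ b) ?_
    have hpb : p b = 0 := by simp [p, max_eq_right hb.le]
    rw [hpb, Real.zero_rpow (lt_max_of_lt_left (neg_pos.2 hb)).ne']
  have hleft : 0 < ∏ x, p x ^ (max (n x) 0) := by
    refine Finset.prod_pos fun x _ => ?_
    rcases le_or_gt (n x) 0 with h | h
    · simp [max_eq_right h]
    · exact Real.rpow_pos_of_pos (div_pos (lt_max_of_lt_left h) hSpos) _
  exact hleft.ne' (heq.trans hright)

end General

section Binary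

variable {k N : ℕ}

/-- Flip the `i`-th coordinate. -/
def flipCoord (i : Fin N) (x : Fin N → Fin 2) : Fin N → Fin 2 :=
  Function.update x i (1 - x i)

theorem flipCoord_of_ne {i j : Fin N} (h : j ≠ i) (x : Fin N → Fin 2) :
    flipCoord i x j = x j :=
  Function.update_of_ne h _ _

theorem flipCoord_involutive (i : Fin N) : Function.Involutive (flipCoord i) := by
  intro x
  simp [flipCoord]

theorem even_sum_flipCoord (i : Fin N) (x : Fin N → Fin 2) :
    Even (∑ j, (flipCoord i x j : ℕ)) ↔ ¬ Even (∑ j, (x j : ℕ)) := by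
  rw [← Finset.add_sum_erase _ _ (Finset.mem_univ i),
    ← Finset.add_sum_erase (a := i) _ (fun j => (x j : ℕ)) (Finset.mem_univ i)]
  have hrest : ∑ j ∈ Finset.univ.erase i, (flipCoord i x j : ℕ)
      = ∑ j ∈ Finset.univ.erase i, (x j : ℕ) :=
    Finset.sum_congr rfl fun j hj => by rw [flipCoord_of_ne (Finset.ne_of_mem_erase hj)]
  have hi : flipCoord i x i = 1 - x i := by simp [flipCoord]
  rw [hrest, hi]
  generalize x i = a
  fin_cases a <;> simp [Nat.even_add_one, Nat.even_add]

open Classical in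
/-- The parity sign restricted to the cylinder through `y` with free coordinates `lam`. -/
noncomputable def cylinderSign (lam : Finset (Fin N)) (y x : Fin N → Fin 2) : ℝ :=
  if ∀ j ∉ lam, x j = y j then if x ∈ Zplus N then 1 else -1 else 0

theorem cylinderSign_flipCoord {lam : Finset (Fin N)} {i : Fin N} (hi : i ∈ lam)
    (y x : Fin N → Fin 2) :
    cylinderSign lam y (flipCoord i x) = -cylinderSign lam y x := by
  have hcyl : (∀ j ∉ lam, flipCoord i x j = y j) ↔ ∀ j ∉ lam, x j = y j :=
    forall₂_congr fun j hj => by rw [flipCoord_of_ne (ne_of_mem_of_not_mem hi hj).symm]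
  have hpar : flipCoord i x ∈ Zplus N ↔ x ∉ Zplus N := even_sum_flipCoord i x
  unfold cylinderSign
  simp only [hcyl, hpar]
  split_ifs <;> simp_all

theorem orthInteractions_cylinderSign {lam : Finset (Fin N)} (hlam : lam.card = k + 1)
    (y : Fin N → Fin 2) :
    OrthInteractions (X := fun _ : Fin N => Fin 2) k (cylinderSign lam y) := by
  intro s g hs hg
  obtain ⟨i, hi, his⟩ := Finset.exists_mem_notMem_of_card_lt_card (s := s) (t := lam) (by omega)
  have hinv := Equiv.sum_comp (flipCoord_involutive i).toPerm
    (fun x => cylinderSign lam y x * g x)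
  have hflip (x) : cylinderSign lam y (flipCoord i x) * g (flipCoord i x)
      = -(cylinderSign lam y x * g x) := by
    rw [cylinderSign_flipCoord hi,
      hg (flipCoord i x) x fun j hj => flipCoord_of_ne (ne_of_mem_of_not_mem hj his) x, neg_mul]
  simp only [Function.Involutive.coe_toPerm, hflip, Finset.sum_neg_distrib] at hinv
  linarith

theorem exists_mem_Zplus_Zminus_sdiff {Y : Set (Fin N → Fin 2)} (hY : IsSSet (EkBin N k) Y)
    {lam : Finset (Fin N)} (hlam : lam.card = k + 1) (y : Fin N → Fin 2) :
    (∃ x ∈ Zplus N \ Y, ∀ j ∉ lam, x j = y j) ∧ ∃ x ∈ Zminus N \ Y, ∀ j ∉ lam, x j = y j := by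
  have horth := orthInteractions_cylinderSign hlam y
  have hpos (x) (h : 0 < cylinderSign lam y x) : x ∈ Zplus N ∧ ∀ j ∉ lam, x j = y j := by
    unfold cylinderSign at h
    split_ifs at h with h₁ h₂
    · exact ⟨h₂, h₁⟩
    · norm_num at h
    · norm_num at h
  have hneg (x) (h : 0 < (-cylinderSign lam y) x) : x ∈ Zminus N ∧ ∀ j ∉ lam, x j = y j := by
    unfold cylinderSign at h
    simp only [Pi.neg_apply] at h
    split_ifs at h with h₁ h₂
    · norm_num at h
    · exact ⟨h₂, h₁⟩
    · norm_num at h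
  obtain ⟨i, hi⟩ := Finset.card_pos.1 (by omega : 0 < lam.card)
  have hy : cylinderSign lam y y = 1 ∨ cylinderSign lam y y = -1 := by
    unfold cylinderSign
    split_ifs <;> simp_all
  have hposex : ∃ x, 0 < cylinderSign lam y x := by
    rcases hy with h | h
    · exact ⟨y, by rw [h]; norm_num⟩
    · exact ⟨flipCoord i y, by rw [cylinderSign_flipCoord hi, h]; norm_num⟩
  have hnegex : ∃ x, 0 < (-cylinderSign lam y) x := by
    rcases hposex with ⟨x, hx⟩
    exact ⟨flipCoord i x, by simpa [cylinderSign_flipCoord hi] using hx⟩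
  obtain ⟨x, hx, hxY⟩ := horth.exists_pos_notMem hposex hY
  obtain ⟨z, hz, hzY⟩ := horth.neg.exists_pos_notMem hnegex hY
  exact ⟨⟨x, ⟨(hpos x hx).1, hxY⟩, (hpos x hx).2⟩, ⟨z, ⟨(hneg z hz).1, hzY⟩, (hneg z hz).2⟩⟩

theorem ncard_Zplus_Zminus (hN : 0 < N) :
    (Zplus N).ncard = 2 ^ (N - 1) ∧ (Zminus N).ncard = 2 ^ (N - 1) := by
  have hcompl : (Zplus N)ᶜ = Zminus N := rfl
  have himage : flipCoord ⟨0, hN⟩ '' Zplus N = Zminus N := by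
    rw [(flipCoord_involutive _).image_eq_preimage_symm]
    ext x
    exact even_sum_flipCoord _ x
  have heq : (Zminus N).ncard = (Zplus N).ncard := by
    rw [← himage, Set.ncard_image_of_injective _ (flipCoord_involutive _).injective]
  have hadd := Set.ncard_add_ncard_compl (Zplus N)
  rw [hcompl, heq, Nat.card_eq_fintype_card, Fintype.card_fun, Fintype.card_fin,
    Fintype.card_fin] at hadd
  have hpow : 2 ^ N = 2 * 2 ^ (N - 1) := by rw [← pow_succ', Nat.sub_add_cancel hN]
  omega

/-- The monomial `∏ i ∈ t, x i` as a real function. -/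
def monomialFun (t : Finset (Fin N)) (x : Fin N → Fin 2) : ℝ := ∏ i ∈ t, ((x i : ℕ) : ℝ)

theorem sum_mul_monomialFun_mul_eq_zero {n : (Fin N → Fin 2) → ℝ}
    (hn : ∀ t : Finset (Fin N), t.card ≤ k → ∑ x, n x * monomialFun t x = 0)
    (s : Finset (Fin N)) :
    ∀ (t : Finset (Fin N)) (g : (Fin N → Fin 2) → ℝ), t.card + s.card ≤ k →
      DependsOnlyOn (X := fun _ => Fin 2) s g → ∑ x, n x * monomialFun t x * g x = 0 := by
  induction s using Finset.induction_on with
  | empty =>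
    intro t g ht hg
    have hconst (x) : g x = g 0 := hg x 0 (by simp)
    simp only [hconst, ← Finset.sum_mul]
    rw [hn t (by simpa using ht), zero_mul]
  | insert i s hi ih =>
    intro t g ht hg
    rw [Finset.card_insert_of_notMem hi] at ht
    have hdep (a : Fin 2) :
        DependsOnlyOn (X := fun _ => Fin 2) s (fun x => g (Function.update x i a)) := by
      intro x y hxy
      refine hg _ _ fun j hj => ?_
      rcases eq_or_ne j i with rfl | hji
      · simp
      · simpa [hji] using hxy j (Finset.mem_of_mem_insert_of_ne hj hji)
    have h₀ := ih t _ (by omega) (hdep 0)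
    have h₁ := ih (insert i t) _ (by have := Finset.card_insert_le i t; omega) (hdep 1)
    have h₂ := ih (insert i t) _ (by have := Finset.card_insert_le i t; omega) (hdep 0)
    have hsplit (x) : n x * monomialFun t x * g x
        = n x * monomialFun t x * g (Function.update x i 0)
          + (n x * monomialFun (insert i t) x * g (Function.update x i 1)
            - n x * monomialFun (insert i t) x * g (Function.update x i 0)) := by
      rcases Fin.exists_fin_two.1 ⟨x i, rfl⟩ with h | h
      · have hz : monomialFun (insert i t) x = 0 :=
          Finset.prod_eq_zero (Finset.mem_insert_self i t) (by simp [h])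
        rw [hz, ← h, Function.update_eq_self]
        ring
      · have ho : monomialFun (insert i t) x = monomialFun t x :=
          Finset.prod_insert_of_eq_one_if_notMem fun _ => by simp [h]
        rw [ho, ← h, Function.update_eq_self]
        ring
    simp only [hsplit, Finset.sum_add_distrib, Finset.sum_sub_distrib, h₀, h₁, h₂]
    ring

theorem orthInteractions_of_monomialFun {n : (Fin N → Fin 2) → ℝ}
    (hn : ∀ t : Finset (Fin N), t.card ≤ k → ∑ x, n x * monomialFun t x = 0) :
    OrthInteractions (X := fun _ : Fin N => Fin 2) k n := by
  intro s g hs hg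
  simpa [monomialFun] using sum_mul_monomialFun_mul_eq_zero hn s ∅ g (by simpa using hs) hg

theorem card_finset_card_le (N k : ℕ) :
    Fintype.card {t : Finset (Fin N) // t.card ≤ k} = ∑ i ∈ Finset.range (k + 1), N.choose i := by
  rw [Fintype.card_subtype, Finset.card_eq_sum_card_fiberwise (f := Finset.card)
    (t := Finset.range (k + 1)) (fun t ht => by simpa [Nat.lt_succ_iff] using ht)]
  refine Finset.sum_congr rfl fun i hi => ?_
  have hfib : (Finset.univ.filter fun t : Finset (Fin N) => t.card ≤ k).filter
      (fun t => t.card = i) = Finset.powersetCard i Finset.univ := by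
    ext t
    have := Finset.mem_range.1 hi
    simp only [Finset.mem_filter, Finset.mem_univ, true_and, Finset.mem_powersetCard,
      Finset.subset_univ]
    omega
  rw [hfib, Finset.card_powersetCard, Finset.card_univ, Fintype.card_fin]

theorem IsSSet.ncard_le_sum_choose {Y : Set (Fin N → Fin 2)} (hY : IsSSet (EkBin N k) Y) :
    Y.ncard ≤ ∑ i ∈ Finset.range (k + 1), N.choose i := by
  classical
  by_contra! hlt
  let T := {t : Finset (Fin N) // t.card ≤ k}
  let extend : (Y → ℝ) →ₗ[ℝ] ((Fin N → Fin 2) → ℝ) :=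
    Function.ExtendByZero.linearMap ℝ (Subtype.val : Y → Fin N → Fin 2)
  let pairing : ((Fin N → Fin 2) → ℝ) →ₗ[ℝ] (T → ℝ) :=
    LinearMap.pi fun t => ∑ x, monomialFun t.1 x • LinearMap.proj x
  have hker : LinearMap.ker (pairing ∘ₗ extend) ≠ ⊥ := by
    refine LinearMap.ker_ne_bot_of_finrank_lt ?_
    rw [Module.finrank_fintype_fun_eq_card, Module.finrank_fintype_fun_eq_card,
      card_finset_card_le, ← Nat.card_eq_fintype_card, Nat.card_coe_set_eq]
    exact hlt
  obtain ⟨c, hc, hc₀⟩ := Submodule.exists_mem_ne_zero_of_ne_bot hker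
  have hext (x : Y) : extend c x = c x := Subtype.val_injective.extend_apply c (0 : (Fin N → Fin 2) → ℝ) x
  have hext₀ (x) (hx : x ∉ Y) : extend c x = 0 :=
    Function.extend_apply' c (0 : (Fin N → Fin 2) → ℝ) x fun ⟨a, ha⟩ => hx (ha ▸ a.2)
  have horth : OrthInteractions (X := fun _ : Fin N => Fin 2) k (extend c) := by
    refine orthInteractions_of_monomialFun fun t ht => ?_
    have h := congrFun (LinearMap.mem_ker.1 hc) ⟨t, ht⟩
    simpa [pairing, mul_comm] using h
  obtain ⟨a, ha⟩ := Function.ne_iff.1 hc₀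
  rw [Pi.zero_apply, ← hext] at ha
  rcases ha.lt_or_gt with h | h
  · obtain ⟨x, hx, hxY⟩ := horth.neg.exists_pos_notMem ⟨a, by simpa using h⟩ hY
    simp [hext₀ x hxY] at hx
  · obtain ⟨x, hx, hxY⟩ := horth.exists_pos_notMem ⟨a, h⟩ hY
    simp [hext₀ x hxY] at hx

end Binary

/-- let `K` be the minimal size of a set of points marking every
`(k+1)`-dimensional cylinder set. Then any S-set `Y` of `E^k` satisfies
`|Y ∩ Z₊| ≤ 2^(N-1) - K`, `|Y ∩ Z₋| ≤ 2^(N-1) - K`, `|Y| ≤ 2^N - 2K`, and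
`|Y| ≤ ∑_{i=0}^k C(N,i)`. -/
theorem stmt_15 (N k : ℕ) (hk : 0 < k) (hkN : k < N) (K : ℕ)
    (hK : K = sInf {n : ℕ | ∃ M : Set (Fin N → Fin 2), M.ncard = n ∧
      ∀ (lam : Finset (Fin N)) (y : Fin N → Fin 2), lam.card = k + 1 →
        ∃ x ∈ M, ∀ j ∉ lam, x j = y j})
    (Y : Set (Fin N → Fin 2)) (hY : IsSSet (EkBin N k) Y) :
    (Y ∩ Zplus N).ncard ≤ 2 ^ (N - 1) - K ∧
    (Y ∩ Zminus N).ncard ≤ 2 ^ (N - 1) - K ∧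
    Y.ncard ≤ 2 ^ N - 2 * K ∧
    Y.ncard ≤ ∑ i ∈ Finset.range (k + 1), N.choose i := by
  have hle (Z : Set (Fin N → Fin 2)) (hZ : Z.ncard = 2 ^ (N - 1))
      (hmark : ∀ (lam : Finset (Fin N)) (y : Fin N → Fin 2), lam.card = k + 1 →
        ∃ x ∈ Z \ Y, ∀ j ∉ lam, x j = y j) : (Y ∩ Z).ncard ≤ 2 ^ (N - 1) - K := by
    have hKle : K ≤ (Z \ Y).ncard := hK ▸ Nat.sInf_le ⟨Z \ Y, rfl, hmark⟩
    have hadd := Set.ncard_inter_add_ncard_sdiff_eq_ncard Z Y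
    rw [Set.inter_comm] at hadd
    omega
  obtain ⟨hplus, hminus⟩ := ncard_Zplus_Zminus (N := N) (by omega)
  have h₁ := hle _ hplus fun lam y hlam => (exists_mem_Zplus_Zminus_sdiff hY hlam y).1
  have h₂ := hle _ hminus fun lam y hlam => (exists_mem_Zplus_Zminus_sdiff hY hlam y).2
  refine ⟨h₁, h₂, ?_, hY.ncard_le_sum_choose⟩
  have hadd : (Y ∩ Zplus N).ncard + (Y ∩ Zminus N).ncard = Y.ncard :=
    Set.ncard_inter_add_ncard_sdiff_eq_ncard Y (Zplus N)
  have hpow : 2 ^ N = 2 * 2 ^ (N - 1) := by rw [← pow_succ', Nat.sub_add_cancel (by omega)]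
  omega
end
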